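/- arXiv:1611.07790 — 11 statements merged into one kernel-verified Lean document; each statement's English description precedes it below -/
import Mathlib

section
/- (Karamata's theorem, direct half) Let L be a positive measurable function on (0,∞) that is slowly varying at infinity and locally bounded on [x₀,∞) for some x₀ ≥ 0, and let α > -1. Then ∫_{x₀}^{x} t^α L(t) dt is asymptotically equivalent to (α+1)^{-1} x^{α+1} L(x) as x → ∞, i.e. the ratio of the two quantities tends to 1. -/
open MeasureTheory Filter Real Set

/-- Uniform convergence theorem for slowly varying functions, in additive form. -/
lemma uniform_of_tendsto_translate_sub {f : ℝ → ℝ} (hf : Measurable f)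
    (h : ∀ u, Tendsto (fun x => f (x + u) - f x) atTop (nhds 0)) {ε : ℝ} (hε : 0 < ε) :
    ∃ X : ℝ, ∀ x ≥ X, ∀ u ∈ Icc (0 : ℝ) 1, |f (x + u) - f x| < ε := by
  by_contra! hcon
  choose x hx u hu hlarge using fun n : ℕ => hcon n
  have hxtop : Tendsto x atTop atTop := tendsto_atTop_mono hx tendsto_natCast_atTop_atTop
  have small_measure : ∀ y : ℕ → ℝ, Tendsto y atTop atTop → ∀ᶠ n in atTop,
      volume ({v | ε / 2 ≤ |f (y n + v) - f (y n)|} ∩ Icc (0 : ℝ) 2) < 1 / 2 := by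
    intro y hy
    have hconv : TendstoInMeasure (volume.restrict (Icc (0 : ℝ) 2))
        (fun n v => f (y n + v) - f (y n)) atTop (fun _ => (0 : ℝ)) := by
      refine tendstoInMeasure_of_tendsto_ae (fun n => ?_) (ae_of_all _ fun v => ?_)
      · exact ((hf.comp (measurable_const_add _)).sub_const _).aestronglyMeasurable
      · exact (h v).comp hy
    have hlim := tendstoInMeasure_iff_norm.1 hconv (ε / 2) (by positivity)
    filter_upwards [hlim.eventually_lt_const (u := 1 / 2) (by simp)] with n hn
    have hmeas : MeasurableSet {v | ε / 2 ≤ |f (y n + v) - f (y n)|} :=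
      measurableSet_le measurable_const
        ((hf.comp (measurable_const_add _)).sub_const _).abs
    simpa [Measure.restrict_apply hmeas] using hn
  have hxu : Tendsto (fun n => x n + u n) atTop atTop :=
    tendsto_atTop_mono (fun n => by linarith [(hu n).1]) hxtop
  obtain ⟨n, hG, hH⟩ := ((small_measure x hxtop).and (small_measure _ hxu)).exists
  set G := {v | ε / 2 ≤ |f (x n + v) - f (x n)|} ∩ Icc (0 : ℝ) 2
  set H := {v | ε / 2 ≤ |f (x n + u n + v) - f (x n + u n)|} ∩ Icc (0 : ℝ) 2
  have hcover : Icc (1 : ℝ) 2 ⊆ G ∪ (fun v => v - u n) ⁻¹' H := by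
    intro v hv
    by_contra hv'
    have hvG : v ∉ G := fun h => hv' (Or.inl h)
    have hvH : v - u n ∉ H := fun h => hv' (Or.inr h)
    have h₁ : |f (x n + v) - f (x n)| < ε / 2 :=
      not_le.1 fun hle => hvG ⟨hle, by linarith [hv.1], hv.2⟩
    have h₂ : |f (x n + u n + (v - u n)) - f (x n + u n)| < ε / 2 :=
      not_le.1 fun hle => hvH ⟨hle, by linarith [hv.1, (hu n).2], by linarith [hv.2, (hu n).1]⟩
    rw [show x n + u n + (v - u n) = x n + v by ring] at h₂
    have h₃ := hlarge n
    rw [abs_lt] at h₁ h₂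
    exact absurd h₃ (not_le.2 (abs_lt.2 ⟨by linarith, by linarith⟩))
  have hle : (1 : ENNReal) ≤ volume G + volume H := by
    calc (1 : ENNReal) = volume (Icc (1 : ℝ) 2) := by rw [Real.volume_Icc]; norm_num
      _ ≤ volume (G ∪ (fun v => v - u n) ⁻¹' H) := measure_mono hcover
      _ ≤ volume G + volume ((fun v => v - u n) ⁻¹' H) := measure_union_le _ _
      _ = volume G + volume H := by
        simp only [sub_eq_add_neg, measure_preimage_add_right]
  have hlt := ENNReal.add_lt_add hG hH
  rw [ENNReal.add_halves] at hlt
  exact absurd hle (not_le.2 hlt)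

/-- Potter's bound for slowly varying functions, in additive form. -/
lemma sub_le_mul_sub_add_of_tendsto_translate_sub {f : ℝ → ℝ} (hf : Measurable f)
    (h : ∀ u, Tendsto (fun x => f (x + u) - f x) atTop (nhds 0)) {δ : ℝ} (hδ : 0 < δ) :
    ∃ X : ℝ, ∀ y ≥ X, ∀ x ≥ y, f y - f x ≤ δ * (x - y) + δ := by
  obtain ⟨X, hX⟩ := uniform_of_tendsto_translate_sub hf h hδ
  have step : ∀ n : ℕ, ∀ y ≥ X, f y - f (y + n) ≤ δ * n := by
    intro n y hy
    induction n with
    | zero => simp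
    | succ k ih =>
      have h₁ := hX (y + k) (by linarith [Nat.cast_nonneg (α := ℝ) k]) 1 (by simp)
      rw [abs_lt] at h₁
      push_cast
      rw [← add_assoc]
      linarith [h₁.1]
  refine ⟨X, fun y hy x hx => ?_⟩
  have hfl := Nat.floor_le (sub_nonneg.2 hx)
  have hlt := Nat.lt_floor_add_one (x - y)
  set n := ⌊x - y⌋₊
  have h₁ := step n y hy
  have h₂ := hX (y + n) (by linarith [Nat.cast_nonneg (α := ℝ) n]) (x - y - n)
    ⟨by linarith, by linarith⟩
  rw [show y + n + (x - y - n) = x by ring, abs_lt] at h₂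
  have h₃ := mul_le_mul_of_nonneg_left hfl hδ.le
  linarith [h₂.1]

/-- One-sided Potter bound for slowly varying functions. -/
lemma potter_bound {L : ℝ → ℝ} (hLpos : ∀ x > 0, 0 < L x) (hLmeas : Measurable L)
    (hLslow : ∀ t > 0, Tendsto (fun x => L (t * x) / L x) atTop (nhds 1))
    {δ : ℝ} (hδ : 0 < δ) :
    ∃ X > 0, ∀ y ≥ X, ∀ x ≥ y, L y ≤ exp δ * (x / y) ^ δ * L x := by
  have hslow : ∀ u, Tendsto (fun x => log (L (exp (x + u))) - log (L (exp x))) atTop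
      (nhds 0) := by
    intro u
    have h₁ := (((hLslow (exp u) (exp_pos u)).comp tendsto_exp_atTop).log one_ne_zero)
    rw [log_one] at h₁
    refine h₁.congr fun x => ?_
    simp only [Function.comp]
    rw [← exp_add, add_comm u x,
      log_div (hLpos _ (exp_pos _)).ne' (hLpos _ (exp_pos _)).ne']
  obtain ⟨X, hX⟩ := sub_le_mul_sub_add_of_tendsto_translate_sub
    (f := fun x => log (L (exp x))) (measurable_log.comp (hLmeas.comp measurable_exp)) hslow hδ
  refine ⟨exp X, exp_pos X, fun y hy x hx => ?_⟩
  have hy0 : 0 < y := (exp_pos X).trans_le hy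
  have hx0 : 0 < x := hy0.trans_le hx
  have h₁ := hX (log y) ((le_log_iff_exp_le hy0).2 hy) (log x) (log_le_log hy0 hx)
  simp only [exp_log hy0, exp_log hx0] at h₁
  rw [← log_le_log_iff (hLpos y hy0) (by have := hLpos x hx0; positivity),
    log_mul (by positivity) (hLpos x hx0).ne', log_mul (exp_pos δ).ne' (by positivity), log_exp,
    log_rpow (by positivity), log_div hx0.ne' hy0.ne']
  linarith

lemma intervalIntegrable_rpow_mul_of_bounded {L : ℝ → ℝ} (hLmeas : Measurable L) {a b C α : ℝ}
    (hab : a ≤ b) (hC : ∀ t ∈ Icc a b, |L t| ≤ C) (hα : -1 < α) :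
    IntervalIntegrable (fun t => t ^ α * L t) volume a b := by
  have hpow : IntervalIntegrable (fun t : ℝ => t ^ α) volume a b :=
    intervalIntegral.intervalIntegrable_rpow' hα
  rw [intervalIntegrable_iff_integrableOn_Ioc_of_le hab] at hpow ⊢
  refine Integrable.mul_bdd (c := C) hpow hLmeas.aestronglyMeasurable ?_
  filter_upwards [ae_restrict_mem measurableSet_Ioc] with t ht
  exact hC t (Ioc_subset_Icc_self ht)

lemma tendsto_rpow_mul_atTop_of_potter {L : ℝ → ℝ} (hLpos : ∀ x > 0, 0 < L x)
    {X δ β : ℝ} (hX0 : 0 < X) (hδβ : δ < β)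
    (hX : ∀ y ≥ X, ∀ x ≥ y, L y ≤ exp δ * (x / y) ^ δ * L x) :
    Tendsto (fun x => x ^ β * L x) atTop atTop := by
  have hc : 0 < L X * X ^ δ * (exp δ)⁻¹ := by have := hLpos X hX0; positivity
  refine tendsto_atTop_mono' _ ?_
    ((tendsto_rpow_atTop (sub_pos.2 hδβ)).const_mul_atTop hc)
  filter_upwards [eventually_ge_atTop X] with x hx
  have hx0 : 0 < x := hX0.trans_le hx
  have h₁ := hX X le_rfl x hx
  rw [div_rpow hx0.le hX0.le] at h₁
  rw [rpow_sub hx0]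
  have hXδ : 0 < X ^ δ := by positivity
  have hxδ : 0 < x ^ δ := by positivity
  have hxβ : 0 < x ^ β := by positivity
  calc L X * X ^ δ * (exp δ)⁻¹ * (x ^ β / x ^ δ)
      ≤ (exp δ * (x ^ δ / X ^ δ) * L x) * X ^ δ * (exp δ)⁻¹ * (x ^ β / x ^ δ) := by gcongr
    _ = x ^ β * L x := by field_simp

/-- Karamata's asymptotics for the integral started at a point from which Potter's bound holds. -/
lemma tendsto_integral_div_of_potter {L : ℝ → ℝ} (hLpos : ∀ x > 0, 0 < L x)
    (hLmeas : Measurable L)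
    (hLslow : ∀ t > 0, Tendsto (fun x => L (t * x) / L x) atTop (nhds 1))
    {X δ α : ℝ} (hX0 : 0 < X) (hα : -1 < α) (hδα : -1 < α - δ)
    (hX : ∀ y ≥ X, ∀ x ≥ y, L y ≤ exp δ * (x / y) ^ δ * L x) :
    Tendsto (fun x => (∫ t in X..x, t ^ α * L t) / (x ^ (α + 1) * L x)) atTop
      (nhds (α + 1)⁻¹) := by
  set g : ℝ → ℝ := (Ioi X).indicator fun t => t ^ α * L t with hg
  have hgmeas : Measurable g :=
    ((measurable_id.pow_const α).mul hLmeas).indicator measurableSet_Ioi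
  have hlim : Tendsto (fun x => ∫ u in (0 : ℝ)..1, g (u * x) / (x ^ α * L x)) atTop
      (nhds (∫ u in (0 : ℝ)..1, u ^ α)) := by
    refine intervalIntegral.tendsto_integral_filter_of_dominated_convergence
      (fun u => exp δ * u ^ (α - δ)) ?_ ?_ ?_ ?_
    · exact Eventually.of_forall fun x =>
        ((hgmeas.comp (measurable_mul_const x)).div_const _).aestronglyMeasurable
    · filter_upwards [eventually_gt_atTop 0] with x hx
      refine ae_of_all _ fun u hu => ?_
      rw [uIoc_of_le zero_le_one] at hu
      have hu0 := hu.1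
      have hLx := hLpos x hx
      by_cases hux : X < u * x
      · rw [hg, indicator_of_mem (show u * x ∈ Ioi X from hux)]
        have hLux := hLpos (u * x) (by positivity)
        have h₁ := hX (u * x) hux.le x (mul_le_of_le_one_left hx.le hu.2)
        rw [norm_of_nonneg (by positivity), mul_rpow hu0.le hx.le, rpow_sub hu0,
          div_le_iff₀ (by positivity)]
        rw [show x / (u * x) = u⁻¹ by field_simp, inv_rpow hu0.le] at h₁
        calc u ^ α * x ^ α * L (u * x)
            ≤ u ^ α * x ^ α * (exp δ * (u ^ δ)⁻¹ * L x) := by gcongr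
          _ = exp δ * (u ^ α / u ^ δ) * (x ^ α * L x) := by ring
      · rw [hg, indicator_of_notMem (show u * x ∉ Ioi X from hux), zero_div, norm_zero]
        positivity
    · exact (intervalIntegral.intervalIntegrable_rpow' hδα).const_mul _
    · refine ae_of_all _ fun u hu => ?_
      rw [uIoc_of_le zero_le_one] at hu
      have hu0 := hu.1
      have h₁ := (hLslow u hu0).const_mul (u ^ α)
      rw [mul_one] at h₁
      refine h₁.congr' ?_
      filter_upwards [eventually_gt_atTop 0,
        (tendsto_id.const_mul_atTop hu0).eventually_gt_atTop X] with x hx hux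
      rw [hg, indicator_of_mem (show u * x ∈ Ioi X from hux), mul_rpow hu0.le hx.le]
      have hLx := hLpos x hx
      have hxα : 0 < x ^ α := by positivity
      field_simp
  rw [integral_rpow (Or.inl hα), one_rpow, zero_rpow (by linarith), sub_zero, one_div] at hlim
  refine hlim.congr' ?_
  filter_upwards [eventually_ge_atTop X] with x hx
  have hx0 : 0 < x := hX0.trans_le hx
  have h₁ : ∫ t in X..x, t ^ α * L t = ∫ t in (0 : ℝ)..x, g t := by
    rw [intervalIntegral.integral_of_le hx, intervalIntegral.integral_of_le hx0.le, hg,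
      setIntegral_indicator measurableSet_Ioi, Ioc_inter_Ioi, sup_eq_right.2 hX0.le]
  have h₂ := intervalIntegral.mul_integral_comp_mul_right (a := 0) (b := 1) (f := g) x
  rw [zero_mul, one_mul] at h₂
  rw [h₁, ← h₂, intervalIntegral.integral_div, rpow_add hx0, rpow_one,
    mul_comm (x ^ α) x, mul_assoc, mul_div_mul_left _ _ hx0.ne']

/-- **Karamata's theorem, direct half.** If `L` is a positive measurable function on `(0,∞)`,
slowly varying at infinity and locally bounded on `[x₀,∞)` for some `x₀ ≥ 0`, and `α > -1`,
then `∫_{x₀}^{x} t^α L(t) dt ~ (α+1)⁻¹ x^{α+1} L(x)` as `x → ∞`. -/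
theorem karamata_direct
    (L : ℝ → ℝ) (x₀ : ℝ) (hx₀ : 0 ≤ x₀)
    (hLpos : ∀ x > 0, 0 < L x)
    (hLmeas : Measurable L)
    (hLslow : ∀ t > 0, Tendsto (fun x => L (t * x) / L x) atTop (nhds 1))
    (hLloc : ∀ b ≥ x₀, ∃ C : ℝ, ∀ t ∈ Set.Icc x₀ b, |L t| ≤ C)
    (α : ℝ) (hα : -1 < α) :
    Tendsto (fun x => (∫ t in x₀..x, t ^ α * L t) / ((α + 1)⁻¹ * x ^ (α + 1) * L x))
      atTop (nhds 1) := by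
  have hα1 : 0 < α + 1 := by linarith
  obtain ⟨X', hX'0, hX'⟩ := potter_bound hLpos hLmeas hLslow (half_pos hα1)
  obtain ⟨X, hX0, hxX, hX⟩ : ∃ X, 0 < X ∧ x₀ ≤ X ∧ ∀ y ≥ X, ∀ x ≥ y,
      L y ≤ exp ((α + 1) / 2) * (x / y) ^ ((α + 1) / 2) * L x :=
    ⟨max X' x₀, lt_max_of_lt_left hX'0, le_max_right _ _,
      fun y hy => hX' y ((le_max_left _ _).trans hy)⟩
  have hint : ∀ b ≥ x₀, IntervalIntegrable (fun t => t ^ α * L t) volume x₀ b := by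
    intro b hb
    obtain ⟨C, hC⟩ := hLloc b hb
    exact intervalIntegrable_rpow_mul_of_bounded hLmeas hb hC hα
  have hhead : Tendsto (fun x => (∫ t in x₀..X, t ^ α * L t) / (x ^ (α + 1) * L x)) atTop
      (nhds 0) :=
    (tendsto_rpow_mul_atTop_of_potter hLpos hX0 (half_lt_self hα1) hX).const_div_atTop _
  have htail := tendsto_integral_div_of_potter hLpos hLmeas hLslow hX0 hα
    (by linarith : -1 < α - (α + 1) / 2) hX
  have hsum := (hhead.add htail).const_mul (α + 1)
  rw [zero_add, mul_inv_cancel₀ hα1.ne'] at hsum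
  refine hsum.congr' ?_
  filter_upwards [eventually_ge_atTop X] with x hx
  rw [← add_div, intervalIntegral.integral_add_adjacent_intervals (hint X hxX)
    ((hint X hxX).symm.trans (hint x (hxX.trans hx)))]
  have hx0 : 0 < x := hX0.trans_le hx
  have hLx := hLpos x hx0
  have hxα : 0 < x ^ (α + 1) := by positivity
  field_simp
end

section
/- (Karamata's theorem, convergent half) Let L be a positive measurable function on (0,∞) that is slowly varying at infinity and locally bounded on [x₀,∞) for some x₀ ≥ 0, and let α < -1. Then ∫_{x}^{∞} t^α L(t) dt is finite for x large enough and is asymptotically equivalent to -(α+1)^{-1} x^{α+1} L(x) as x → ∞, i.e. the ratio of the two quantities tends to 1. -/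
open MeasureTheory Filter Real Set

/-- A measurable function all of whose increments tend to `0` at infinity has, far enough out,
uniformly bounded increments over steps in `[0, 1]`. -/
theorem exists_forall_abs_increment_le {h : ℝ → ℝ} (hm : Measurable h)
    (hh : ∀ s, Tendsto (fun x => h (x + s) - h x) atTop (nhds 0)) :
    ∃ X, ∀ x ≥ X, ∀ s ∈ Icc (0 : ℝ) 1, |h (x + s) - h x| ≤ 2 := by
  set A : ℝ → Set ℝ := fun x => Icc 0 2 ∩ {s | |h (x + s) - h x| ≤ 1} with hA
  have hAm : ∀ x, MeasurableSet (A x) := fun x =>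
    measurableSet_Icc.inter (measurableSet_le (by fun_prop) measurable_const)
  have hlim : Tendsto (fun x => volume (A x)) atTop (nhds (volume (Icc (0 : ℝ) 2))) := by
    refine tendsto_measure_of_ae_tendsto_indicator atTop measurableSet_Icc hAm
      (B := Icc (0 : ℝ) 2) measurableSet_Icc (by simp)
      (Eventually.of_forall fun x => inter_subset_left)
      (Eventually.of_forall fun s => ?_)
    filter_upwards [(hh s).eventually (Metric.closedBall_mem_nhds 0 one_pos)] with x hx
    rw [dist_zero_right, norm_eq_abs] at hx
    simp [hA, hx]
  obtain ⟨X, hX⟩ := eventually_atTop.1 (hlim.eventually (lt_mem_nhds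
    (show ENNReal.ofReal (3 / 2) < volume (Icc (0 : ℝ) 2) by
      rw [Real.volume_Icc]
      exact (ENNReal.ofReal_lt_ofReal_iff (by norm_num)).2 (by norm_num))))
  refine ⟨X, fun x hx s hs => ?_⟩
  have hvol : volume (Icc (0 : ℝ) 3) <
      volume (A x) + volume ((fun a => a + -s) ⁻¹' A (x + s)) := by
    rw [measure_preimage_add_right]
    refine lt_of_eq_of_lt ?_ (ENNReal.add_lt_add (hX x hx) (hX (x + s) (by linarith [hs.1])))
    rw [Real.volume_Icc, ← ENNReal.ofReal_add (by norm_num) (by norm_num)]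
    norm_num
  obtain ⟨a, ⟨-, ha⟩, -, hb⟩ := nonempty_inter_of_measure_lt_add volume (u := Icc 0 3)
    ((measurable_add_const (-s)) (hAm (x + s)))
    (fun a (ha : a ∈ A x) => ⟨ha.1.1, ha.1.2.trans (by norm_num)⟩)
    (fun a ha => ⟨by linarith [ha.1.1, hs.1], by linarith [ha.1.2, hs.2]⟩) hvol
  simp only [mem_ofPred_eq] at ha hb
  rw [show x + s + (a + -s) = x + a by ring] at hb
  rw [abs_le] at *
  constructor <;> linarith [ha.1, ha.2, hb.1, hb.2]

/-- A measurable function all of whose increments tend to `0` at infinity grows, far enough out,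
at most linearly with arbitrarily small slope, uniformly in the starting point. -/
theorem exists_forall_increment_le_mul_add {h : ℝ → ℝ} (hm : Measurable h)
    (hh : ∀ s, Tendsto (fun x => h (x + s) - h x) atTop (nhds 0)) {δ : ℝ} (hδ : 0 < δ) :
    ∃ X, ∀ x ≥ X, ∀ s ≥ 0, h (x + s) - h x ≤ δ * s + 2 := by
  obtain ⟨X, hX⟩ := exists_forall_abs_increment_le hm hh
  obtain ⟨Y, hY⟩ := eventually_atTop.1 ((hh 1).eventually (gt_mem_nhds hδ))
  have hstep : ∀ (n : ℕ), ∀ x ≥ Y, h (x + n) - h x ≤ δ * n := by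
    intro n x hx
    induction n with
    | zero => simp
    | succ n ih =>
      have := hY (x + n) (hx.trans (by simp))
      push_cast
      rw [← add_assoc]
      linarith
  refine ⟨max X Y, fun x hx s hs => ?_⟩
  have hfl := Nat.floor_le hs
  have hfl' := (Nat.lt_floor_add_one s).le
  have hrem := (abs_le.1 (hX (x + ⌊s⌋₊)
    (by linarith [le_max_left X Y, Nat.cast_nonneg (α := ℝ) ⌊s⌋₊])
    (s - ⌊s⌋₊) ⟨by linarith, by linarith⟩)).2
  rw [show x + ⌊s⌋₊ + (s - ⌊s⌋₊) = x + s by ring] at hrem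
  linarith [hstep ⌊s⌋₊ x ((le_max_right X Y).trans hx), mul_le_mul_of_nonneg_left hfl hδ.le]

/-- One-sided **Potter bound** for slowly varying functions. -/
theorem exists_forall_slowlyVarying_le {L : ℝ → ℝ} (hLpos : ∀ x > 0, 0 < L x)
    (hLmeas : Measurable L)
    (hLslow : ∀ t > 0, Tendsto (fun x => L (t * x) / L x) atTop (nhds 1))
    {δ : ℝ} (hδ : 0 < δ) :
    ∃ X > 0, ∀ x ≥ X, ∀ t ≥ 1, L (t * x) / L x ≤ exp 2 * t ^ δ := by
  have hh : ∀ s, Tendsto (fun x => log (L (exp (x + s))) - log (L (exp x))) atTop (nhds 0) := by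
    intro s
    have := ((hLslow (exp s) (exp_pos s)).comp tendsto_exp_atTop).log one_ne_zero
    rw [log_one] at this
    refine this.congr fun x => ?_
    rw [Function.comp_apply, log_div (hLpos _ (by positivity)).ne' (hLpos _ (exp_pos x)).ne',
      ← exp_add, add_comm s]
  obtain ⟨X, hX⟩ := exists_forall_increment_le_mul_add
    (h := fun x => log (L (exp x))) (by fun_prop) hh hδ
  refine ⟨exp X, exp_pos X, fun x hx t ht => ?_⟩
  have hx0 : 0 < x := (exp_pos X).trans_le hx
  have ht0 : 0 < t := one_pos.trans_le ht
  have key := hX (log x) ((le_log_iff_exp_le hx0).2 hx) (log t) (log_nonneg ht)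
  rw [exp_add, exp_log hx0, exp_log ht0, mul_comm x,
    ← log_div (hLpos _ (by positivity)).ne' (hLpos _ hx0).ne',
    log_le_iff_le_exp (div_pos (hLpos _ (by positivity)) (hLpos _ hx0))] at key
  rwa [rpow_def_of_pos ht0, ← exp_add, add_comm 2, mul_comm (log t)]

/-- **Karamata's theorem, convergent half.** If `L` is a positive measurable function on `(0,∞)`,
slowly varying at infinity and locally bounded on `[x₀,∞)` for some `x₀ ≥ 0`, and `α < -1`,
then `∫_{x}^{∞} t^α L(t) dt` is finite for all large `x` and is asymptotically equivalent to
`-(α+1)⁻¹ x^{α+1} L(x)` as `x → ∞`. -/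
theorem karamata_convergent
    (L : ℝ → ℝ) (x₀ : ℝ) (hx₀ : 0 ≤ x₀)
    (hLpos : ∀ x > 0, 0 < L x)
    (hLmeas : Measurable L)
    (hLslow : ∀ t > 0, Tendsto (fun x => L (t * x) / L x) atTop (nhds 1))
    (hLloc : ∀ b ≥ x₀, ∃ C : ℝ, ∀ t ∈ Set.Icc x₀ b, |L t| ≤ C)
    (α : ℝ) (hα : α < -1) :
    (∀ᶠ x in atTop, IntegrableOn (fun t => t ^ α * L t) (Set.Ioi x)) ∧
    Tendsto (fun x => (∫ t in Set.Ioi x, t ^ α * L t) / (-(α + 1)⁻¹ * x ^ (α + 1) * L x))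
      atTop (nhds 1) := by
  obtain ⟨X, hX0, hX⟩ := exists_forall_slowlyVarying_le hLpos hLmeas hLslow
    (δ := -(α + 1) / 2) (by linarith)
  have hα0 : α + 1 ≠ 0 := by linarith
  set F : ℝ → ℝ → ℝ := fun x s => s ^ α * (L (s * x) / L x) with hF
  have hFmeas : ∀ x, AEStronglyMeasurable (F x) (volume.restrict (Ioi 1)) := fun x =>
    Measurable.aestronglyMeasurable (by fun_prop)
  have hbound_int : IntegrableOn (fun s : ℝ => exp 2 * s ^ (α + -(α + 1) / 2)) (Ioi 1) :=
    (integrableOn_Ioi_rpow_of_lt (by linarith) one_pos).const_mul _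
  have hbound : ∀ x ≥ X, ∀ᵐ s ∂volume.restrict (Ioi 1),
      ‖F x s‖ ≤ exp 2 * s ^ (α + -(α + 1) / 2) := by
    intro x hx
    filter_upwards [ae_restrict_mem measurableSet_Ioi] with s hs
    have hs0 : 0 < s := one_pos.trans hs
    have hx0 : 0 < x := hX0.trans_le hx
    have hL := div_pos (hLpos (s * x) (by positivity)) (hLpos x hx0)
    rw [norm_of_nonneg (by positivity), rpow_add hs0, mul_left_comm]
    exact mul_le_mul_of_nonneg_left (hX x hx s (le_of_lt hs)) (by positivity)
  have hscale : ∀ x > 0, ∀ s ∈ Ioi (1 : ℝ),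
      (s * x) ^ α * L (s * x) = x ^ α * L x * F x s := by
    intro x hx s hs
    have := (hLpos x hx).ne'
    rw [mul_rpow (zero_le_one.trans (le_of_lt hs)) hx.le]
    simp only [hF]
    field_simp
  constructor
  · filter_upwards [eventually_ge_atTop X] with x hx
    have hx0 : 0 < x := hX0.trans_le hx
    have hint : IntegrableOn (fun s => x ^ α * L x * F x s) (Ioi 1) :=
      (hbound_int.mono' (hFmeas x) (hbound x hx)).const_mul _
    rw [← one_mul x, ← integrableOn_Ioi_comp_mul_right_iff _ _ hx0]
    exact hint.congr_fun (fun s hs => (hscale x hx0 s hs).symm) measurableSet_Ioi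
  · have hlim : Tendsto (fun x => ∫ s in Ioi 1, F x s) atTop
        (nhds (∫ s in Ioi (1 : ℝ), s ^ α)) := by
      refine tendsto_integral_filter_of_dominated_convergence _
        (Eventually.of_forall hFmeas) (eventually_atTop.2 ⟨X, hbound⟩) hbound_int ?_
      filter_upwards [ae_restrict_mem measurableSet_Ioi] with s hs
      simpa using (hLslow s (one_pos.trans hs)).const_mul (s ^ α)
    rw [integral_Ioi_rpow_of_lt hα one_pos, one_rpow] at hlim
    have hlim' := hlim.const_mul (-(α + 1))
    rw [show -(α + 1) * (-1 / (α + 1)) = 1 by field_simp] at hlim'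
    refine hlim'.congr' ?_
    filter_upwards [eventually_ge_atTop X] with x hx
    have hx0 : 0 < x := hX0.trans_le hx
    have hLx := (hLpos x hx0).ne'
    have hxα := (rpow_pos_of_pos hx0 α).ne'
    have hsub := integral_comp_mul_right_Ioi (fun t => t ^ α * L t) 1 hx0
    rw [setIntegral_congr_fun measurableSet_Ioi (hscale x hx0), integral_const_mul, one_mul,
      smul_eq_mul, eq_inv_mul_iff_mul_eq₀ hx0.ne'] at hsub
    rw [← hsub, rpow_add hx0, rpow_one]
    field_simp
end

section
/- (Integral behavior of rapidly varying functions, direct half) Let h be a positive, non-increasing function on (0,∞) that is rapidly varying at infinity. Then there exists z > 0 such that for every α ∈ ℝ the integral ∫_z^∞ t^α h(t) dt is finite, and moreover x^{α+1} h(x) / ∫_x^∞ t^α h(t) dt → ∞ as x → ∞. -/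
open MeasureTheory Filter Real Set

/-- Potter-type bound: a rapidly varying non-increasing function decays, relative to its value
at any large `x`, faster than any given power. -/
lemma exists_forall_le_rpow_neg_of_rapidly_varying {h : ℝ → ℝ}
    (hpos : ∀ x > 0, 0 < h x) (hanti : AntitoneOn h (Ioi 0))
    (hrapid : Tendsto (fun x => h (2 * x) / h x) atTop (nhds 0)) {β : ℝ} (hβ : 0 ≤ β) :
    ∃ X : ℝ, 1 ≤ X ∧ ∀ x ≥ X, ∀ s ≥ 1, h (x * s) ≤ 2 ^ β * s ^ (-β) * h x := by
  have hc : (0 : ℝ) < 2 ^ (-β) := by positivity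
  obtain ⟨X₀, hX₀⟩ := eventually_atTop.1 (hrapid.eventually_lt_const hc)
  have hpow : ∀ n : ℕ, ∀ x ≥ max X₀ 1, h (2 ^ n * x) ≤ (2 ^ (-β)) ^ n * h x := by
    intro n
    induction n with
    | zero => simp
    | succ n ih =>
      intro x hx
      have hx1 : 1 ≤ x := (le_max_right _ _).trans hx
      have hstep : h (2 * x) ≤ 2 ^ (-β) * h x :=
        ((div_lt_iff₀ (hpos x (by linarith))).1 (hX₀ x ((le_max_left _ _).trans hx))).le
      calc h (2 ^ (n + 1) * x) = h (2 ^ n * (2 * x)) := by ring_nf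
        _ ≤ (2 ^ (-β)) ^ n * h (2 * x) := ih _ (by linarith)
        _ ≤ (2 ^ (-β)) ^ n * (2 ^ (-β) * h x) := by gcongr
        _ = (2 ^ (-β)) ^ (n + 1) * h x := by ring
  refine ⟨max X₀ 1, le_max_right _ _, fun x hx s hs => ?_⟩
  have hx0 : 0 < x := by linarith [(le_max_right X₀ 1).trans hx]
  obtain ⟨n, hn, hn'⟩ := exists_nat_pow_near hs (one_lt_two : (1 : ℝ) < 2)
  have hs0 : 0 < s := by linarith
  have hmono : h (x * s) ≤ h (2 ^ n * x) :=
    hanti (mem_Ioi.2 (by positivity)) (mem_Ioi.2 (by positivity)) (by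
      rw [mul_comm]; gcongr)
  refine hmono.trans ((hpow n x hx).trans ?_)
  have hhx := (hpos x hx0).le
  gcongr
  calc ((2 : ℝ) ^ (-β)) ^ n = 2 ^ β * (2 ^ (n + 1)) ^ (-β) := by
        rw [← rpow_natCast, ← rpow_natCast, ← rpow_mul (by norm_num), ← rpow_mul (by norm_num),
          ← rpow_add (by norm_num)]
        congr 1
        push_cast
        ring
    _ ≤ 2 ^ β * s ^ (-β) := by
        gcongr ?_ * ?_
        exact rpow_le_rpow_of_nonpos hs0 hn'.le (by linarith)

lemma aestronglyMeasurable_rpow_mul_comp_mul {h : ℝ → ℝ} (hanti : AntitoneOn h (Ioi 0))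
    (α : ℝ) {x a : ℝ} (hx : 0 < x) (ha : 0 ≤ a) :
    AEStronglyMeasurable (fun s => s ^ α * h (x * s)) (volume.restrict (Ioi a)) := by
  have hanti' : AntitoneOn (fun s => h (x * s)) (Ioi a) := by
    intro s hs t ht hst
    have hs0 : 0 < s := ha.trans_lt hs
    have ht0 : 0 < t := ha.trans_lt ht
    exact hanti (mem_Ioi.2 (by positivity)) (mem_Ioi.2 (by positivity)) (by gcongr)
  have hmeas := aemeasurable_restrict_of_antitoneOn (μ := volume) measurableSet_Ioi hanti'
  exact ((measurable_id.pow_const α).aemeasurable.mul hmeas).aestronglyMeasurable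

lemma integrableOn_rpow_mul_Ioi_one_of_rapidly_varying {h : ℝ → ℝ}
    (hpos : ∀ x > 0, 0 < h x) (hanti : AntitoneOn h (Ioi 0))
    (hrapid : Tendsto (fun x => h (2 * x) / h x) atTop (nhds 0)) (α : ℝ) :
    IntegrableOn (fun t => t ^ α * h t) (Ioi 1) := by
  obtain ⟨X, hX1, hX⟩ := exists_forall_le_rpow_neg_of_rapidly_varying hpos hanti hrapid
    (β := |α| + 2) (by positivity)
  have hX0 : 0 < X := by linarith
  have hcompact : IntegrableOn (fun t => t ^ α * h t) (Icc 1 X) := by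
    refine IntegrableOn.continuousOn_mul ?_ ?_ isCompact_Icc
    · exact fun t ht => (continuousAt_rpow_const t α
        (Or.inl (by linarith [ht.1]))).continuousWithinAt
    · exact (hanti.mono fun t ht => mem_Ioi.2 (by linarith [ht.1])).integrableOn_isCompact
        isCompact_Icc
  have hscaled : IntegrableOn (fun s => s ^ α * h (X * s)) (Ioi 1) := by
    have hdom : IntegrableOn (fun s : ℝ => 2 ^ (|α| + 2) * h X * s ^ (α - (|α| + 2))) (Ioi 1) :=
      (integrableOn_Ioi_rpow_of_lt (by linarith [le_abs_self α]) one_pos).const_mul _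
    refine hdom.mono' (aestronglyMeasurable_rpow_mul_comp_mul hanti α hX0 zero_le_one) ?_
    filter_upwards [ae_restrict_mem measurableSet_Ioi] with s hs
    have hs1 : 1 < s := hs
    have hs0 : 0 < s := by linarith
    have hh := hpos (X * s) (by positivity)
    rw [norm_of_nonneg (by positivity)]
    calc s ^ α * h (X * s) ≤ s ^ α * (2 ^ (|α| + 2) * s ^ (-(|α| + 2)) * h X) := by
          gcongr
          exact hX X le_rfl s hs1.le
      _ = _ := by rw [sub_eq_add_neg, rpow_add hs0]; ring
  have htail : IntegrableOn (fun t => t ^ α * h t) (Ioi X) := by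
    have hcomp : IntegrableOn (fun s => (X * s) ^ α * h (X * s)) (Ioi 1) := by
      refine IntegrableOn.congr_fun (hscaled.const_mul (X ^ α)) (fun s hs => ?_) measurableSet_Ioi
      have hs1 : 1 < s := hs
      simp only [mul_rpow hX0.le (by linarith : 0 ≤ s)]
      ring
    simpa using (integrableOn_Ioi_comp_mul_left_iff (fun t => t ^ α * h t) 1 hX0).1 hcomp
  exact (hcompact.union htail).mono_set fun t ht =>
    (le_or_gt t X).imp (fun h' => ⟨(mem_Ioi.1 ht).le, h'⟩) id

lemma tendsto_integral_rpow_mul_div_of_rapidly_varying {h : ℝ → ℝ}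
    (hpos : ∀ x > 0, 0 < h x) (hanti : AntitoneOn h (Ioi 0))
    (hrapid : ∀ t > 1, Tendsto (fun x => h (t * x) / h x) atTop (nhds 0)) (α : ℝ) :
    Tendsto (fun x => (∫ t in Ioi x, t ^ α * h t) / (x ^ (α + 1) * h x)) atTop (nhds 0) := by
  obtain ⟨X, hX1, hX⟩ := exists_forall_le_rpow_neg_of_rapidly_varying hpos hanti
    (hrapid 2 one_lt_two) (β := |α| + 2) (by positivity)
  have hlim : Tendsto (fun x => ∫ s in Ioi (1 : ℝ), s ^ α * h (x * s) / h x) atTop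
      (nhds (∫ _ in Ioi (1 : ℝ), (0 : ℝ))) := by
    refine tendsto_integral_filter_of_dominated_convergence
      (fun s : ℝ => 2 ^ (|α| + 2) * s ^ (α - (|α| + 2))) ?_ ?_ ?_ ?_
    · filter_upwards [eventually_gt_atTop 0] with x hx
      simpa only [div_eq_mul_inv] using
        (aestronglyMeasurable_rpow_mul_comp_mul hanti α hx zero_le_one).mul_const (h x)⁻¹
    · filter_upwards [eventually_ge_atTop X] with x hx
      filter_upwards [ae_restrict_mem measurableSet_Ioi] with s hs
      have hs1 : 1 < s := hs
      have hs0 : 0 < s := by linarith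
      have hx0 : 0 < x := by linarith
      have hhx := hpos x hx0
      have hh := hpos (x * s) (by positivity)
      rw [norm_of_nonneg (by positivity), div_le_iff₀ hhx]
      calc s ^ α * h (x * s) ≤ s ^ α * (2 ^ (|α| + 2) * s ^ (-(|α| + 2)) * h x) := by
            gcongr
            exact hX x hx s hs1.le
        _ = _ := by rw [sub_eq_add_neg, rpow_add hs0]; ring
    · exact (integrableOn_Ioi_rpow_of_lt (by linarith [le_abs_self α]) one_pos).const_mul _
    · filter_upwards [ae_restrict_mem measurableSet_Ioi] with s hs
      simpa [mul_div_assoc, mul_comm s] using (hrapid s hs).const_mul (s ^ α)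
  rw [integral_zero] at hlim
  refine hlim.congr' ?_
  filter_upwards [eventually_gt_atTop 0] with x hx
  have hhx := hpos x hx
  have hsubst := integral_comp_mul_left_Ioi (fun t => t ^ α * h t) 1 hx
  rw [mul_one, smul_eq_mul, eq_inv_mul_iff_mul_eq₀ hx.ne'] at hsubst
  have hfactor : ∫ s in Ioi (1 : ℝ), (x * s) ^ α * h (x * s) =
      x ^ α * h x * ∫ s in Ioi (1 : ℝ), s ^ α * h (x * s) / h x := by
    rw [← integral_const_mul]
    refine setIntegral_congr_fun measurableSet_Ioi fun s hs => ?_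
    have hs1 : 1 < s := hs
    simp only [mul_rpow hx.le (by linarith : 0 ≤ s)]
    field_simp
  rw [← hsubst, hfactor, rpow_add_one hx.ne']
  have hxα : 0 < x ^ α := rpow_pos_of_pos hx α
  field_simp

/-- **Integral behavior of rapidly varying functions, direct half.** If `h` is a positive,
non-increasing function on `(0,∞)` that is rapidly varying at infinity, then there exists
`z > 0` such that for every `α ∈ ℝ` the integral `∫_z^∞ t^α h(t) dt` is finite, and moreover
`x^{α+1} h(x) / ∫_x^∞ t^α h(t) dt → ∞` as `x → ∞`. -/
theorem rapidly_varying_integral_direct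
    (h : ℝ → ℝ)
    (hpos : ∀ x > 0, 0 < h x)
    (hanti : AntitoneOn h (Set.Ioi 0))
    (hrapid : ∀ t > 1, Tendsto (fun x => h (t * x) / h x) atTop (nhds 0)) :
    ∃ z > (0:ℝ),
      (∀ α : ℝ, IntegrableOn (fun t => t ^ α * h t) (Set.Ioi z)) ∧
      (∀ α : ℝ, Tendsto (fun x => x ^ (α + 1) * h x / ∫ t in Set.Ioi x, t ^ α * h t)
        atTop atTop) := by
  have hint := integrableOn_rpow_mul_Ioi_one_of_rapidly_varying hpos hanti (hrapid 2 one_lt_two)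
  refine ⟨1, one_pos, hint, fun α => ?_⟩
  have hlim := tendsto_integral_rpow_mul_div_of_rapidly_varying hpos hanti hrapid α
  have hratio_pos : ∀ᶠ x in atTop,
      (∫ t in Ioi x, t ^ α * h t) / (x ^ (α + 1) * h x) ∈ Ioi (0 : ℝ) := by
    filter_upwards [eventually_ge_atTop 1] with x hx
    have hx0 : 0 < x := by linarith
    have hfpos : ∀ t ∈ Ioi x, 0 < t ^ α * h t := fun t ht =>
      mul_pos (rpow_pos_of_pos (hx0.trans ht) α) (hpos t (hx0.trans ht))
    refine div_pos ?_ (mul_pos (rpow_pos_of_pos hx0 _) (hpos x hx0))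
    rw [setIntegral_pos_iff_support_of_nonneg_ae
      ((ae_restrict_mem measurableSet_Ioi).mono fun t ht => (hfpos t ht).le)
      ((hint α).mono_set (Ioi_subset_Ioi hx)),
      inter_eq_self_of_subset_right, volume_Ioi]
    · exact ENNReal.zero_lt_top
    · exact fun t ht => (hfpos t ht).ne'
  simpa only [Function.comp_def, inv_div] using
    tendsto_inv_nhdsGT_zero.comp (tendsto_nhdsWithin_iff.2 ⟨hlim, hratio_pos⟩)
end

section
/- (Integral behavior of rapidly varying functions, converse half) Let h be a positive, non-increasing function on (0,∞). If for some α ∈ ℝ the integral ∫_1^∞ t^α h(t) dt is finite and x^{α+1} h(x) / ∫_x^∞ t^α h(t) dt → ∞ as x → ∞, then h is rapidly varying at infinity. -/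
open MeasureTheory Filter Real Set

/-- On `[1, t]` the power function `u ↦ u ^ α` is bounded below by its smaller endpoint value. -/
lemma min_one_rpow_le_rpow {t u : ℝ} (α : ℝ) (hu : 1 ≤ u) (hut : u ≤ t) :
    min 1 (t ^ α) ≤ u ^ α := by
  rcases le_total 0 α with hα | hα
  · exact (min_le_left _ _).trans (one_le_rpow hu hα)
  · exact (min_le_right _ _).trans (rpow_le_rpow_of_nonpos (by linarith) hut hα)

/-- The tail integral of `s ^ α * h s` dominates its part over `(x, t * x]`, where `h` is at
least `h (t * x)`. -/
lemma mul_le_setIntegral_Ioi_rpow_mul {h : ℝ → ℝ} (hpos : ∀ x > 0, 0 < h x)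
    (hanti : AntitoneOn h (Set.Ioi 0)) {α x t : ℝ} (hx : 0 < x) (ht : 1 < t)
    (hint : IntegrableOn (fun s => s ^ α * h s) (Set.Ioi x)) :
    (t - 1) * min 1 (t ^ α) * x ^ (α + 1) * h (t * x) ≤ ∫ s in Set.Ioi x, s ^ α * h s := by
  have hxt : x ≤ t * x := by nlinarith
  have hbound : ∀ s ∈ Ioc x (t * x), min 1 (t ^ α) * x ^ α * h (t * x) ≤ s ^ α * h s := by
    rintro s ⟨hxs, hst⟩
    have hs : 0 < s := hx.trans hxs
    have hpow : min 1 (t ^ α) * x ^ α ≤ s ^ α := by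
      have hmin := min_one_rpow_le_rpow α ((one_le_div hx).2 hxs.le) ((div_le_iff₀ hx).2 hst)
      rwa [div_rpow hs.le hx.le, le_div_iff₀ (rpow_pos_of_pos hx α)] at hmin
    exact mul_le_mul hpow (hanti hs (hs.trans_le hst) hst) (hpos _ (hs.trans_le hst)).le
      (rpow_nonneg hs.le α)
  calc (t - 1) * min 1 (t ^ α) * x ^ (α + 1) * h (t * x)
      = ∫ _ in Ioc x (t * x), min 1 (t ^ α) * x ^ α * h (t * x) := by
        rw [setIntegral_const, Real.volume_real_Ioc_of_le hxt, rpow_add_one hx.ne', smul_eq_mul]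
        ring
    _ ≤ ∫ s in Ioc x (t * x), s ^ α * h s :=
        setIntegral_mono_on (integrableOn_const (by simp)) (hint.mono_set Ioc_subset_Ioi_self)
          measurableSet_Ioc hbound
    _ ≤ ∫ s in Ioi x, s ^ α * h s := by
        refine setIntegral_mono_set hint ?_ Ioc_subset_Ioi_self.eventuallyLE
        filter_upwards [ae_restrict_mem measurableSet_Ioi] with s hs
        have hs0 : 0 < s := hx.trans hs
        exact mul_nonneg (rpow_nonneg hs0.le α) (hpos s hs0).le

/-- **Integral behavior of rapidly varying functions, converse half.** Let `h` be a positive,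
non-increasing function on `(0,∞)`. If for some `α ∈ ℝ` the integral `∫_1^∞ t^α h(t) dt` is
finite and `x^{α+1} h(x) / ∫_x^∞ t^α h(t) dt → ∞` as `x → ∞`, then `h` is rapidly varying
at infinity. -/
theorem rapidly_varying_integral_converse
    (h : ℝ → ℝ)
    (hpos : ∀ x > 0, 0 < h x)
    (hanti : AntitoneOn h (Set.Ioi 0))
    (α : ℝ)
    (hint : IntegrableOn (fun t => t ^ α * h t) (Set.Ioi 1))
    (hlim : Tendsto (fun x => x ^ (α + 1) * h x / ∫ t in Set.Ioi x, t ^ α * h t)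
      atTop atTop) :
    ∀ t > 1, Tendsto (fun x => h (t * x) / h x) atTop (nhds 0) := by
  intro t ht
  have hC : 0 < (t - 1) * min 1 (t ^ α) :=
    mul_pos (by linarith) (lt_min one_pos (rpow_pos_of_pos (by linarith) α))
  have hzero := hlim.inv_tendsto_atTop.const_mul ((t - 1) * min 1 (t ^ α))⁻¹
  rw [mul_zero] at hzero
  refine squeeze_zero' ?_ ?_ hzero
  · filter_upwards [eventually_gt_atTop 0] with x hx
    exact (div_pos (hpos _ (by positivity)) (hpos x hx)).le
  · filter_upwards [eventually_ge_atTop 1] with x hx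
    have hx0 : 0 < x := by linarith
    have hle := mul_le_setIntegral_Ioi_rpow_mul hpos hanti hx0 ht
      (hint.mono_set (Ioi_subset_Ioi hx))
    have hp : 0 < x ^ (α + 1) := rpow_pos_of_pos hx0 _
    rw [Pi.inv_apply, inv_div, inv_mul_eq_div, div_div, div_le_div_iff₀ (hpos x hx0)
      (mul_pos (mul_pos hp (hpos x hx0)) hC)]
    calc h (t * x) * (x ^ (α + 1) * h x * ((t - 1) * min 1 (t ^ α)))
        = (t - 1) * min 1 (t ^ α) * x ^ (α + 1) * h (t * x) * h x := by ring
      _ ≤ _ := mul_le_mul_of_nonneg_right hle (hpos x hx0).le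
end

section
/- (Monotone density theorem) Let u : (0,∞) → ℝ be a locally integrable function that is monotone on (z,∞) for some z > 0, and set U(x) = ∫_0^x u(y) dy. Suppose U(x) is asymptotically equivalent to c x^α L(x) as x → ∞, where c > 0, α ∈ ℝ with α ≠ 0, and L is slowly varying at infinity. Then u(x) is asymptotically equivalent to c α x^{α-1} L(x) as x → ∞, i.e. u(x) / (c α x^{α-1} L(x)) → 1. -/
open MeasureTheory Filter Real Set

/-- The integral of a monotone function is at least its left value times the length. -/
lemma MonotoneOn.mul_sub_le_intervalIntegral {u : ℝ → ℝ} {x y : ℝ} (hxy : x ≤ y)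
    (hu : MonotoneOn u (Icc x y)) : u x * (y - x) ≤ ∫ t in x..y, u t := by
  have h := intervalIntegral.integral_mono_on (μ := volume) hxy intervalIntegrable_const
    (MonotoneOn.intervalIntegrable (by rwa [uIcc_of_le hxy]))
    (fun t ht => hu (left_mem_Icc.2 hxy) ht ht.1)
  simpa [mul_comm] using h

/-- The integral of a monotone function is at most its right value times the length. -/
lemma MonotoneOn.intervalIntegral_le_mul_sub {u : ℝ → ℝ} {x y : ℝ} (hxy : x ≤ y)
    (hu : MonotoneOn u (Icc x y)) : ∫ t in x..y, u t ≤ u y * (y - x) := by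
  have h := intervalIntegral.integral_mono_on (μ := volume) hxy
    (MonotoneOn.intervalIntegrable (by rwa [uIcc_of_le hxy])) intervalIntegrable_const
    (fun t ht => hu ht (right_mem_Icc.2 hxy) ht.2)
  simpa [mul_comm] using h

/-- Difference quotients, along dilations, of a function asymptotic to `k * x ^ α * L x`. -/
lemma tendsto_dilation_quotient {U L : ℝ → ℝ} {α k s : ℝ} (hs : 0 < s)
    (hLpos : ∀ x > 0, 0 < L x)
    (hLslow : Tendsto (fun x => L (s * x) / L x) atTop (nhds 1))
    (hU : Tendsto (fun x => U x / (x ^ α * L x)) atTop (nhds k)) :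
    Tendsto (fun x => (U (s * x) - U x) / (s * x - x) / (x ^ (α - 1) * L x)) atTop
      (nhds (k * slope (fun t : ℝ => t ^ α) 1 s)) := by
  have hUs := hU.comp (tendsto_id.const_mul_atTop hs)
  have h := (((hUs.mul hLslow).mul_const (s ^ α)).sub hU).div_const (s - 1)
  have hval : (k * 1 * s ^ α - k) / (s - 1) = k * slope (fun t : ℝ => t ^ α) 1 s := by
    rw [slope_def_field, one_rpow]
    ring
  rw [hval] at h
  refine h.congr' ?_
  filter_upwards [eventually_gt_atTop 0] with x hx
  have hL := (hLpos x hx).ne'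
  have hLs := (hLpos (s * x) (mul_pos hs hx)).ne'
  have hxα := (rpow_pos_of_pos hx α).ne'
  have hsα := (rpow_pos_of_pos hs α).ne'
  have hfactor : s * x - x = (s - 1) * x := by ring
  simp only [Function.comp_apply, id, mul_rpow hs.le hx.le, rpow_sub_one hx.ne', hfactor]
  rcases eq_or_ne s 1 with rfl | hs1
  · simp
  have hs1' := sub_ne_zero.2 hs1
  field_simp

/-- Monotone density theorem for a nondecreasing density, with an arbitrary real constant. -/
lemma MonotoneOn.tendsto_density {u L : ℝ → ℝ} {z α k : ℝ} (hz : 0 < z)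
    (huloc : ∀ x > 0, IntegrableOn u (Ioc 0 x)) (hu : MonotoneOn u (Ioi z))
    (hLpos : ∀ x > 0, 0 < L x)
    (hLslow : ∀ t > 0, Tendsto (fun x => L (t * x) / L x) atTop (nhds 1))
    (hU : Tendsto (fun x => (∫ y in (0 : ℝ)..x, u y) / (x ^ α * L x)) atTop (nhds k)) :
    Tendsto (fun x => u x / (x ^ (α - 1) * L x)) atTop (nhds (k * α)) := by
  have hquot {s : ℝ} (hs : 0 < s) := tendsto_dilation_quotient hs hLpos (hLslow s hs) hU
  have hincr {x y : ℝ} (hx : 0 < x) (hy : 0 < y) :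
      (∫ t in (0 : ℝ)..y, u t) - (∫ t in (0 : ℝ)..x, u t) = ∫ t in x..y, u t :=
    intervalIntegral.integral_interval_sub_left
      ((intervalIntegrable_iff_integrableOn_Ioc_of_le hy.le).2 (huloc y hy))
      ((intervalIntegrable_iff_integrableOn_Ioc_of_le hx.le).2 (huloc x hx))
  have hslope : Tendsto (fun s => k * slope (fun t : ℝ => t ^ α) 1 s) (nhdsWithin 1 {1}ᶜ)
      (nhds (k * α)) := by
    have hd : HasDerivAt (fun t : ℝ => t ^ α) α 1 := by
      simpa using hasDerivAt_rpow_const (x := 1) (p := α) (Or.inl one_ne_zero)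
    exact (hasDerivAt_iff_tendsto_slope.1 hd).const_mul k
  have hden {x : ℝ} (hx : 0 < x) : 0 < x ^ (α - 1) * L x :=
    mul_pos (rpow_pos_of_pos hx _) (hLpos x hx)
  refine tendsto_order.2 ⟨fun a ha => ?_, fun a ha => ?_⟩
  · have hleft := hslope.mono_left (nhdsWithin_mono (s := Iio 1) 1 fun s hs => ne_of_lt hs)
    obtain ⟨s, hsa, hs0, hs1⟩ :=
      ((hleft.eventually_const_lt ha).and (Ioo_mem_nhdsLT zero_lt_one)).exists
    filter_upwards [(hquot hs0).eventually_const_lt hsa, eventually_gt_atTop z,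
      (tendsto_id.const_mul_atTop hs0).eventually_gt_atTop z] with x hxa hx hsx
    have hx0 := hz.trans hx
    have hlt : s * x < x := by nlinarith
    refine hxa.trans_le (div_le_div_of_nonneg_right ?_ (hden hx0).le)
    have hbound := MonotoneOn.intervalIntegral_le_mul_sub hlt.le
      (hu.mono fun t ht => lt_of_lt_of_le hsx ht.1)
    rw [← neg_div_neg_eq, div_le_iff₀ (by linarith)]
    linarith [hincr (mul_pos hs0 hx0) hx0]
  · have hright := hslope.mono_left (nhdsWithin_mono (s := Ioi 1) 1 fun s hs => ne_of_gt hs)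
    obtain ⟨s, hsa, hs1⟩ :=
      ((hright.eventually_lt_const ha).and self_mem_nhdsWithin).exists
    have hs0 : 0 < s := zero_lt_one.trans hs1
    filter_upwards [(hquot hs0).eventually_lt_const hsa, eventually_gt_atTop z] with x hxa hx
    have hx0 := hz.trans hx
    have hlt : x < s * x := by nlinarith
    refine (div_le_div_of_nonneg_right ?_ (hden hx0).le).trans_lt hxa
    rw [le_div_iff₀ (by linarith), hincr hx0 (mul_pos hs0 hx0)]
    exact MonotoneOn.mul_sub_le_intervalIntegral hlt.le
      (hu.mono fun t ht => lt_of_lt_of_le hx ht.1)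

/-- **Monotone density theorem.** Let `u : (0,∞) → ℝ` be locally integrable and monotone
on `(z,∞)` for some `z > 0`, and set `U(x) = ∫_0^x u(y) dy`. If `U(x) ~ c x^α L(x)` as
`x → ∞` with `c > 0`, `α ≠ 0` and `L` slowly varying at infinity, then
`u(x) ~ c α x^{α-1} L(x)` as `x → ∞`. -/
theorem monotone_density_theorem
    (u : ℝ → ℝ) (z : ℝ) (hz : 0 < z)
    (huloc : ∀ x > 0, IntegrableOn u (Set.Ioc 0 x))
    (humono : MonotoneOn u (Set.Ioi z) ∨ AntitoneOn u (Set.Ioi z))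
    (U : ℝ → ℝ) (hU : ∀ x, U x = ∫ y in (0:ℝ)..x, u y)
    (c : ℝ) (hc : 0 < c) (α : ℝ) (hα : α ≠ 0)
    (L : ℝ → ℝ)
    (hLpos : ∀ x > 0, 0 < L x)
    (hLmeas : Measurable L)
    (hLslow : ∀ t > 0, Tendsto (fun x => L (t * x) / L x) atTop (nhds 1))
    (hUasymp : Tendsto (fun x => U x / (c * x ^ α * L x)) atTop (nhds 1)) :
    Tendsto (fun x => u x / (c * α * x ^ (α - 1) * L x)) atTop (nhds 1) := by
  have hUc : Tendsto (fun x => (∫ y in (0 : ℝ)..x, u y) / (x ^ α * L x)) atTop (nhds c) := by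
    have h := hUasymp.const_mul c
    rw [mul_one] at h
    refine h.congr fun x => ?_
    rw [hU, mul_assoc c, ← mul_div_assoc, mul_div_mul_left _ _ hc.ne']
  have hlim : Tendsto (fun x => u x / (x ^ (α - 1) * L x)) atTop (nhds (c * α)) := by
    rcases humono with hu | hu
    · exact hu.tendsto_density hz huloc hLpos hLslow hUc
    · have h := hu.neg.tendsto_density (k := -c) (α := α) hz (fun x hx => (huloc x hx).neg)
        hLpos hLslow (by simpa [neg_div] using hUc.neg)
      simpa [neg_div] using h.neg
  have h := hlim.div_const (c * α)
  rw [div_self (mul_ne_zero hc.ne' hα)] at h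
  refine h.congr fun x => ?_
  rw [div_div, mul_comm (_ * L x), ← mul_assoc]
end

section
/- (Theorem 1, regularly varying channel power, unbounded near field) Consider the multi-slope pathloss setup with β₀ > 0 and set δ₀ = d/β₀. Suppose F̄_m(x) > 0 for all x and F̄_m is regularly varying at infinity with index -α for some α ∈ [0,∞). Then F̄_P is regularly varying at infinity with index -min(δ₀, α), i.e. for every u > 0, F̄_P(ut)/F̄_P(t) → u^{-min(δ₀,α)} as t → ∞. -/
open MeasureTheory Filter Real Set

/-- Boundedness of dilation ratios of a regularly varying function. -/
lemma eventually_dilation_le {F : ℝ → ℝ} {α : ℝ} (hpos : ∀ x, 0 < F x)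
    (hrv : ∀ u > (0:ℝ), Tendsto (fun x => F (u * x) / F x) atTop (nhds (u ^ (-α))))
    {a : ℝ} (ha : 0 < a) : ∃ C > 0, ∀ᶠ t in atTop, F (a * t) ≤ C * F t := by
  refine ⟨a ^ (-α) + 1, by positivity, ?_⟩
  filter_upwards [(hrv a ha).eventually_lt_const (lt_add_one _)] with t ht
  exact ((div_lt_iff₀ (hpos t)).1 ht).le

/-- A Potter-type bound: for `γ > α`, the function `x ↦ F x * x ^ γ` is almost increasing. -/
lemma exists_mul_rpow_le {F : ℝ → ℝ} {α γ : ℝ} (hanti : Antitone F) (hpos : ∀ x, 0 < F x)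
    (hle : ∀ x, F x ≤ 1)
    (hrv : ∀ u > (0:ℝ), Tendsto (fun x => F (u * x) / F x) atTop (nhds (u ^ (-α))))
    (hα : 0 ≤ α) (hγ : α < γ) :
    ∃ C ≥ 1, ∃ x₀ > 0, ∀ x ≥ x₀, ∀ y, 0 < y → y ≤ x → F y * y ^ γ ≤ C * (F x * x ^ γ) := by
  have hγ0 : 0 < γ := hα.trans_lt hγ
  have hhalf : ((1 / 2 : ℝ)) ^ (-α) < 2 ^ γ := by
    rw [one_div, Real.inv_rpow (by norm_num), ← Real.rpow_neg (by norm_num), neg_neg]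
    exact Real.rpow_lt_rpow_of_exponent_lt (by norm_num) hγ
  obtain ⟨x₁, hx₁⟩ := eventually_atTop.1
    ((hrv (1 / 2) (by norm_num)).eventually_lt_const hhalf)
  obtain ⟨x₀, hx₀, hx₀1⟩ : ∃ x₀ : ℝ, 0 < x₀ ∧ x₁ ≤ x₀ :=
    ⟨max x₁ 1, lt_max_of_lt_right one_pos, le_max_left _ _⟩
  have hdouble : ∀ x ≥ x₀, F (x / 2) ≤ 2 ^ γ * F x := fun x hx => by
    have := (div_lt_iff₀ (hpos x)).1 (hx₁ x (hx₀1.trans hx))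
    rw [one_div, inv_mul_eq_div] at this
    exact this.le
  have h2γ : (1 : ℝ) ≤ 2 ^ γ := Real.one_le_rpow (by norm_num) hγ0.le
  set C := 2 ^ γ / F (2 * x₀) with hC
  have hCγ : 2 ^ γ ≤ C := by
    rw [hC, le_div_iff₀ (hpos _)]
    exact mul_le_of_le_one_right (by positivity) (hle _)
  have key : ∀ n : ℕ, ∀ x ≥ x₀, x ≤ 2 ^ (n + 1) * x₀ → ∀ y, 0 < y → y ≤ x →
      F y * y ^ γ ≤ C * (F x * x ^ γ) := by
    intro n
    induction n with
    | zero =>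
      intro x hx hx2 y hy hyx
      rw [zero_add, pow_one] at hx2
      have h1 : F y * y ^ γ ≤ 1 * (2 * x₀) ^ γ :=
        mul_le_mul (hle y) (Real.rpow_le_rpow hy.le (hyx.trans hx2) hγ0.le)
          (by positivity) zero_le_one
      have h2 : F (2 * x₀) * x₀ ^ γ ≤ F x * x ^ γ :=
        mul_le_mul (hanti hx2) (Real.rpow_le_rpow hx₀.le hx hγ0.le) (by positivity) (hpos x).le
      calc F y * y ^ γ ≤ 1 * (2 * x₀) ^ γ := h1
        _ = C * (F (2 * x₀) * x₀ ^ γ) := by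
          have := (hpos (2 * x₀)).ne'
          rw [hC, Real.mul_rpow (by norm_num) hx₀.le]; field_simp
        _ ≤ _ := mul_le_mul_of_nonneg_left h2 (by linarith)
    | succ n ih =>
      intro x hx hx2 y hy hyx
      have hx0 : 0 < x := hx₀.trans_le hx
      by_cases hsmall : x ≤ 2 ^ (n + 1) * x₀
      · exact ih x hx hsmall y hy hyx
      have hd := hdouble x hx
      rcases le_or_gt y (x / 2) with hy2 | hy2
      · have hx' : x₀ ≤ x / 2 := by
          have : (1 : ℝ) ≤ 2 ^ n := one_le_pow₀ (by norm_num)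
          rw [pow_succ] at hsmall
          nlinarith
        refine (ih (x / 2) hx' (by rw [pow_succ] at hx2; linarith) y hy hy2).trans ?_
        refine mul_le_mul_of_nonneg_left ?_ (by linarith)
        rw [Real.div_rpow hx0.le (by norm_num), mul_div_assoc', div_le_iff₀ (by positivity)]
        nlinarith [Real.rpow_pos_of_pos hx0 γ]
      · have h1 : F y * y ^ γ ≤ F (x / 2) * x ^ γ :=
          mul_le_mul (hanti hy2.le) (Real.rpow_le_rpow hy.le hyx hγ0.le) (by positivity)
            (hpos _).le
        have hxγ := Real.rpow_pos_of_pos hx0 γ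
        have h2 : F (x / 2) * x ^ γ ≤ C * F x * x ^ γ :=
          mul_le_mul_of_nonneg_right
            (hd.trans (mul_le_mul_of_nonneg_right hCγ (hpos x).le)) hxγ.le
        linarith
  refine ⟨C, h2γ.trans hCγ, x₀, hx₀, fun x hx => ?_⟩
  obtain ⟨n, hn⟩ := pow_unbounded_of_one_lt (x / x₀) (one_lt_two (α := ℝ))
  refine key n x hx ?_
  rw [div_lt_iff₀ hx₀] at hn
  rw [pow_succ]
  nlinarith [pow_pos (two_pos (α := ℝ)) n]

/-- Integrability of a weighted mixture of dilations of a bounded monotone function. -/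
lemma integrable_dilation_mul {X : Type*} [MeasurableSpace X] {μ : Measure X} {F : ℝ → ℝ}
    {g w : X → ℝ} (hanti : Antitone F) (hpos : ∀ x, 0 < F x) (hle : ∀ x, F x ≤ 1)
    (hg : AEMeasurable g μ) (hw : Integrable w μ) (t : ℝ) :
    Integrable (fun r => F (t * g r) * w r) μ := by
  refine hw.bdd_mul (c := 1)
    (hanti.measurable.comp_aemeasurable (hg.const_mul t)).aestronglyMeasurable ?_
  exact Eventually.of_forall fun r => by
    rw [Real.norm_of_nonneg (hpos _).le]; exact hle _

/-- A Breiman-type asymptotic: mixing dilations of a regularly varying tail `F` over a weight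
with a finite moment of order `-γ`, `γ > α`, gives a multiple of `F` asymptotically. -/
lemma tendsto_integral_dilation_div {X : Type*} [MeasurableSpace X] {μ : Measure X}
    {F : ℝ → ℝ} {α γ : ℝ} {g w : X → ℝ}
    (hanti : Antitone F) (hpos : ∀ x, 0 < F x) (hle : ∀ x, F x ≤ 1)
    (hrv : ∀ u > (0:ℝ), Tendsto (fun x => F (u * x) / F x) atTop (nhds (u ^ (-α))))
    (hα : 0 ≤ α) (hγ : α < γ) (hg : AEMeasurable g μ) (hgpos : ∀ᵐ r ∂μ, 0 < g r)
    (hw : Integrable w μ) (hgw : Integrable (fun r => g r ^ (-γ) * w r) μ) :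
    Tendsto (fun t => (∫ r, F (t * g r) * w r ∂μ) / F t) atTop
      (nhds (∫ r, g r ^ (-α) * w r ∂μ)) := by
  obtain ⟨C, hC, x₀, hx₀, hpot⟩ := exists_mul_rpow_le hanti hpos hle hrv hα hγ
  simp_rw [← integral_div]
  refine tendsto_integral_filter_of_dominated_convergence
    (fun r => C * ‖g r ^ (-γ) * w r‖ + ‖w r‖) ?_ ?_ ((hgw.norm.const_mul C).add hw.norm) ?_
  · exact Eventually.of_forall fun t =>
      ((integrable_dilation_mul hanti hpos hle hg hw t).div_const _).aestronglyMeasurable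
  · filter_upwards [eventually_ge_atTop x₀] with t ht
    filter_upwards [hgpos] with r hr
    have ht0 : 0 < t := hx₀.trans_le ht
    have hgγ := Real.rpow_pos_of_pos hr (-γ)
    rw [norm_div, norm_mul, norm_mul, Real.norm_of_nonneg (hpos _).le,
      Real.norm_of_nonneg (hpos _).le, Real.norm_of_nonneg hgγ.le, div_le_iff₀ (hpos t)]
    have hwn := norm_nonneg (w r)
    rcases le_total (g r) 1 with h1 | h1
    · have h := hpot t ht (t * g r) (by positivity) (mul_le_of_le_one_right ht0.le h1)
      rw [Real.mul_rpow ht0.le hr.le] at h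
      have hkey : F (t * g r) ≤ C * g r ^ (-γ) * F t := by
        rw [Real.rpow_neg hr.le]
        have h1 := Real.rpow_pos_of_pos hr γ
        have h2 := Real.rpow_pos_of_pos ht0 γ
        rw [← div_eq_mul_inv, div_mul_eq_mul_div, le_div_iff₀ h1]
        refine le_of_mul_le_mul_right ?_ h2
        linarith
      nlinarith [mul_le_mul_of_nonneg_right hkey hwn, mul_nonneg hwn (hpos t).le]
    · have hkey : F (t * g r) ≤ F t := hanti (le_mul_of_one_le_right ht0.le h1)
      have : 0 ≤ C * (g r ^ (-γ) * ‖w r‖) := by positivity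
      nlinarith [mul_le_mul_of_nonneg_right hkey hwn, mul_nonneg this (hpos t).le]
  · filter_upwards [hgpos] with r hr
    have := (hrv (g r) hr).mul_const (w r)
    refine this.congr fun t => ?_
    rw [mul_comm t, div_mul_eq_mul_div]

/-- A function asymptotic to a nonzero multiple of a regularly varying one is regularly varying. -/
lemma tendsto_ratio_of_tendsto_div {F G : ℝ → ℝ} {α L : ℝ} (hpos : ∀ x, 0 < F x)
    (hrv : ∀ u > (0:ℝ), Tendsto (fun x => F (u * x) / F x) atTop (nhds (u ^ (-α))))
    (hL : L ≠ 0) (hG : Tendsto (fun t => G t / F t) atTop (nhds L)) {u : ℝ} (hu : 0 < u) :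
    Tendsto (fun t => G (u * t) / G t) atTop (nhds (u ^ (-α))) := by
  have h1 : Tendsto (fun t => G (u * t) / F (u * t)) atTop (nhds L) :=
    hG.comp (tendsto_id.const_mul_atTop hu)
  have h2 := (h1.mul (hrv u hu)).mul (hG.inv₀ hL)
  rw [mul_comm L, mul_assoc, mul_inv_cancel₀ hL, mul_one] at h2
  refine h2.congr fun t => ?_
  have := (hpos t).ne'
  have := (hpos (u * t)).ne'
  rw [inv_div]
  field_simp

/-- If `G (u * t) - u ^ (-δ) * G t` is dominated by `F t`, which is negligible against `G t`, then
`G (u * t) / G t` tends to `u ^ (-δ)`. -/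
lemma tendsto_ratio_of_abs_sub_le {F G : ℝ → ℝ} {q C u : ℝ} (hpos : ∀ x, 0 < F x)
    (hG : Tendsto (fun t => G t / F t) atTop atTop)
    (h : ∀ᶠ t in atTop, |G (u * t) - q * G t| ≤ C * F t) :
    Tendsto (fun t => G (u * t) / G t) atTop (nhds q) := by
  have hlim : Tendsto (fun t => C * (G t / F t)⁻¹) atTop (nhds 0) := by
    simpa using hG.inv_tendsto_atTop.const_mul C
  rw [tendsto_iff_norm_sub_tendsto_zero]
  refine squeeze_zero' (Eventually.of_forall fun t => norm_nonneg _) ?_ hlim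
  filter_upwards [h, hG.eventually_gt_atTop 0] with t ht hGF
  have hGt : 0 < G t := by
    have := mul_pos hGF (hpos t)
    rwa [div_mul_cancel₀ _ (hpos t).ne'] at this
  have : G (u * t) / G t - q = (G (u * t) - q * G t) / G t := by field_simp
  rw [this, Real.norm_eq_abs, abs_div, abs_of_pos hGt, inv_div, ← mul_div_assoc]
  gcongr

section TwoZone

variable {F l : ℝ → ℝ} {α A b c κ ρ D : ℝ} {d : ℕ}

lemma integrableOn_const_mul_pow (x y : ℝ) (n : ℕ) :
    IntegrableOn (fun r : ℝ => κ * r ^ n) (Ioo x y) :=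
  ((by fun_prop : Continuous fun r : ℝ => κ * r ^ n).integrableOn_Icc).mono_set
    Ioo_subset_Icc_self

/-- The moment of order `-γ` of a pathloss with near-field exponent `b` is finite if
`b * γ < d`. -/
lemma integrableOn_pathloss_rpow_neg {γ : ℝ} (hd : 0 < d) (hA : 0 < A) (hc : 0 < c) (hD : 0 < D)
    (hγ : 0 < γ) (hbγ : b * γ < d)
    (hl : AEMeasurable l (volume.restrict (Ioo 0 D)))
    (hnear : ∀ r, 0 < r → r < ρ → l r = A * r ^ b)
    (hfar : ∀ r, ρ ≤ r → r < D → c ≤ l r) :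
    IntegrableOn (fun r => l r ^ (-γ) * (κ * r ^ (d - 1))) (Ioo 0 D) := by
  have hint1 : IntegrableOn (fun r : ℝ => A ^ (-γ) * (|κ| * r ^ ((d : ℝ) - 1 - b * γ)))
      (Ioo 0 D) := by
    refine Integrable.const_mul (Integrable.const_mul ?_ _) _
    exact (intervalIntegrable_iff_integrableOn_Ioo_of_le hD.le).1
      (intervalIntegral.intervalIntegrable_rpow' (by linarith))
  have hint2 : IntegrableOn (fun r : ℝ => c ^ (-γ) * (|κ| * r ^ (d - 1))) (Ioo 0 D) :=
    (integrableOn_const_mul_pow 0 D (d - 1)).const_mul _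
  refine (hint1.add hint2).mono' ?_ ?_
  · exact ((hl.pow_const _).mul (by fun_prop)).aestronglyMeasurable
  · filter_upwards [ae_restrict_mem measurableSet_Ioo] with r hr
    have hr0 := hr.1
    simp only [Pi.add_apply]
    rw [norm_mul, norm_mul, Real.norm_eq_abs κ, norm_pow, Real.norm_of_nonneg hr0.le]
    rcases lt_or_ge r ρ with h | h
    · rw [hnear r hr0 h, Real.norm_of_nonneg (by positivity),
        Real.mul_rpow hA.le (by positivity), ← Real.rpow_mul hr0.le, ← Real.rpow_natCast,
        Nat.cast_sub hd, Nat.cast_one]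
      have : r ^ ((d : ℝ) - 1 - b * γ) = r ^ (b * -γ) * r ^ ((d : ℝ) - 1) := by
        rw [← Real.rpow_add hr0]; ring_nf
      rw [this]
      have : 0 ≤ c ^ (-γ) * (|κ| * r ^ ((d : ℝ) - 1)) := by positivity
      linarith
    · have hcl := hfar r h hr.2
      have hlpos : 0 < l r := hc.trans_le hcl
      rw [Real.norm_of_nonneg (by positivity)]
      have h1 : l r ^ (-γ) ≤ c ^ (-γ) :=
        Real.rpow_le_rpow_of_nonpos hc hcl (by linarith)
      have h2 : 0 ≤ A ^ (-γ) * (|κ| * r ^ ((d : ℝ) - 1 - b * γ)) := by positivity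
      have h3 : 0 ≤ |κ| * r ^ (d - 1) := by positivity
      nlinarith [mul_le_mul_of_nonneg_right h1 h3]

lemma pathloss_pos (hA : 0 < A) (hc : 0 < c)
    (hnear : ∀ r, 0 < r → r < ρ → l r = A * r ^ b)
    (hfar : ∀ r, ρ ≤ r → r < D → c ≤ l r) {r : ℝ} (hr : r ∈ Ioo 0 D) : 0 < l r := by
  rcases lt_or_ge r ρ with h | h
  · rw [hnear r hr.1 h]
    have := hr.1
    positivity
  · exact hc.trans_le (hfar r h hr.2)

/-- Below the critical index, the mixed tail is asymptotic to a positive multiple of `F`. -/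
lemma exists_tendsto_pathloss_div
    (hanti : Antitone F) (hpos : ∀ x, 0 < F x) (hle : ∀ x, F x ≤ 1)
    (hrv : ∀ u > (0:ℝ), Tendsto (fun x => F (u * x) / F x) atTop (nhds (u ^ (-α))))
    (hα : 0 ≤ α) (hd : 0 < d) (hA : 0 < A) (hb : 0 < b) (hc : 0 < c) (hκ : 0 < κ) (hD : 0 < D)
    (hl : AEMeasurable l (volume.restrict (Ioo 0 D)))
    (hnear : ∀ r, 0 < r → r < ρ → l r = A * r ^ b)
    (hfar : ∀ r, ρ ≤ r → r < D → c ≤ l r) (hαd : α < d / b) :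
    ∃ L ≠ 0, Tendsto (fun t => (∫ r in 0..D, F (t * l r) * (κ * r ^ (d - 1))) / F t) atTop
      (nhds L) := by
  obtain ⟨γ, hγ, hγd⟩ := exists_between hαd
  rw [lt_div_iff₀' hb] at hγd
  have hlpos : ∀ r ∈ Ioo 0 D, 0 < l r := fun r hr => pathloss_pos hA hc hnear hfar hr
  have hwint := integrableOn_const_mul_pow (κ := κ) 0 D (d - 1)
  have hlim := tendsto_integral_dilation_div hanti hpos hle hrv hα hγ hl
    ((ae_restrict_mem measurableSet_Ioo).mono hlpos) hwint
    (integrableOn_pathloss_rpow_neg hd hA hc hD (hα.trans_lt hγ) hγd hl hnear hfar)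
  simp_rw [← integral_Ioc_eq_integral_Ioo, ← intervalIntegral.integral_of_le hD.le] at hlim
  refine ⟨_, ne_of_gt ?_, hlim⟩
  refine intervalIntegral.intervalIntegral_pos_of_pos_on ?_ (fun r hr => ?_) hD
  · rw [intervalIntegrable_iff_integrableOn_Ioo_of_le hD.le]
    rcases hα.eq_or_lt with rfl | hα'
    · simpa using hwint
    · exact integrableOn_pathloss_rpow_neg hd hA hc hD hα' (by nlinarith) hl hnear hfar
  · have := hlpos r hr
    have := hr.1
    positivity

/-- At or above the critical index, `F` is negligible against the mixed tail. -/
lemma tendsto_pathloss_div_atTop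
    (hanti : Antitone F) (hpos : ∀ x, 0 < F x) (hle : ∀ x, F x ≤ 1)
    (hrv : ∀ u > (0:ℝ), Tendsto (fun x => F (u * x) / F x) atTop (nhds (u ^ (-α))))
    (hα : 0 ≤ α) (hd : 0 < d) (hA : 0 < A) (hb : 0 < b) (hκ : 0 < κ) (hρ : 0 < ρ) (hρD : ρ ≤ D)
    (hl : AEMeasurable l (volume.restrict (Ioo 0 D)))
    (hnear : ∀ r, 0 < r → r < ρ → l r = A * r ^ b) (hαd : d / b ≤ α) :
    Tendsto (fun t => (∫ r in 0..D, F (t * l r) * (κ * r ^ (d - 1))) / F t) atTop atTop := by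
  have hD : 0 < D := hρ.trans_le hρD
  rw [div_le_iff₀' hb] at hαd
  refine tendsto_atTop.2 fun M => ?_
  set k := A ^ (-α) * κ * ρ ^ ((d : ℝ) - b * α) with hk
  have hkpos : 0 < k := by positivity
  obtain ⟨ε, hε, hερ, hεM⟩ : ∃ ε, 0 < ε ∧ ε < ρ ∧ M < k * log (ρ / ε) := by
    refine ⟨ρ * exp (-(|M| / k + 1)), by positivity, ?_, ?_⟩
    · refine mul_lt_of_lt_one_right hρ (Real.exp_lt_one_iff.2 ?_)
      have : 0 ≤ |M| / k := by positivity
      linarith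
    · rw [div_mul_cancel_left₀ hρ.ne', ← exp_neg, neg_neg, log_exp, mul_add,
        mul_div_cancel₀ _ hkpos.ne']
      linarith [le_abs_self M]
  have hsub : Ioo ε ρ ⊆ Ioo 0 D := Ioo_subset_Ioo hε.le hρD
  have hwint := integrableOn_const_mul_pow (κ := κ) ε ρ (d - 1)
  have hcont : ∀ s : ℝ, IntegrableOn (fun r : ℝ => (A * r ^ b) ^ s * (κ * r ^ (d - 1)))
      (Ioo ε ρ) := fun s => by
    refine (ContinuousOn.integrableOn_Icc fun r hr => ?_).mono_set Ioo_subset_Icc_self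
    have hr0 : 0 < r := hε.trans_le hr.1
    have h1 : ContinuousAt (fun r : ℝ => A * r ^ b) r :=
      continuousAt_const.mul (Real.continuousAt_rpow_const _ _ (Or.inl hr0.ne'))
    have h2 : A * r ^ b ≠ 0 := by positivity
    exact ((h1.rpow_const (Or.inl h2)).mul (by fun_prop)).continuousWithinAt
  have hlim := tendsto_integral_dilation_div (μ := volume.restrict (Ioo ε ρ))
    (g := fun r => A * r ^ b) hanti hpos hle hrv hα
    (lt_add_one α) (by fun_prop)
    (by
      filter_upwards [ae_restrict_mem measurableSet_Ioo] with r hr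
      have := hε.trans hr.1
      positivity) hwint (hcont _)
  have hlow : k * log (ρ / ε) ≤ ∫ r in Ioo ε ρ, (A * r ^ b) ^ (-α) * (κ * r ^ (d - 1)) := by
    rw [← integral_inv_of_pos hε hρ, ← intervalIntegral.integral_const_mul,
      intervalIntegral.integral_of_le hερ.le, integral_Ioc_eq_integral_Ioo]
    refine setIntegral_mono_on ?_ (hcont _) measurableSet_Ioo fun r hr => ?_
    · refine (ContinuousOn.integrableOn_Icc fun r hr => ?_).mono_set Ioo_subset_Icc_self
      have hr0 : r ≠ 0 := (hε.trans_le hr.1).ne'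
      exact (continuousAt_const.mul (continuousAt_inv₀ hr0)).continuousWithinAt
    · have hr0 : 0 < r := hε.trans hr.1
      have h1 : ρ ^ ((d : ℝ) - b * α) ≤ r ^ ((d : ℝ) - b * α) :=
        Real.rpow_le_rpow_of_nonpos hr0 hr.2.le (by linarith)
      have h2 : (A * r ^ b) ^ (-α) * (κ * r ^ (d - 1))
          = A ^ (-α) * κ * r ^ ((d : ℝ) - b * α) * r⁻¹ := by
        rw [Real.mul_rpow hA.le (by positivity), ← Real.rpow_mul hr0.le, ← Real.rpow_natCast,
          Nat.cast_sub hd, Nat.cast_one, ← Real.rpow_neg_one r]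
        have : r ^ (b * -α) * r ^ ((d : ℝ) - 1) = r ^ ((d : ℝ) - b * α) * r ^ (-1 : ℝ) := by
          rw [← Real.rpow_add hr0, ← Real.rpow_add hr0]; ring_nf
        linear_combination A ^ (-α) * κ * this
      rw [h2, hk]
      gcongr
  filter_upwards [hlim.eventually_const_lt (hεM.trans_le hlow)] with t ht
  refine ht.le.trans (div_le_div_of_nonneg_right ?_ (hpos t).le)
  rw [intervalIntegral.integral_of_le hD.le, integral_Ioc_eq_integral_Ioo]
  calc ∫ r in Ioo ε ρ, F (t * (A * r ^ b)) * (κ * r ^ (d - 1))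
      = ∫ r in Ioo ε ρ, F (t * l r) * (κ * r ^ (d - 1)) :=
        setIntegral_congr_fun measurableSet_Ioo fun r hr => by
          simp only [hnear r (hε.trans hr.1) hr.2]
    _ ≤ _ := by
        refine setIntegral_mono_set (integrable_dilation_mul hanti hpos hle hl
          (integrableOn_const_mul_pow 0 D (d - 1)) t) ?_ hsub.eventuallyLE
        filter_upwards [ae_restrict_mem measurableSet_Ioo] with r hr
        have := hr.1
        have := hpos (t * l r)
        simp only [Pi.zero_apply]
        positivity

/-- An integral of `F (t * g r)` over a zone on which `g` is bounded below is `O(F t)`. -/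
lemma eventually_abs_integral_dilation_le {g w : ℝ → ℝ} {x y W : ℝ}
    (hanti : Antitone F) (hpos : ∀ x, 0 < F x)
    (hrv : ∀ u > (0:ℝ), Tendsto (fun x => F (u * x) / F x) atTop (nhds (u ^ (-α))))
    (hc : 0 < c) (hg : ∀ᵐ r, r ∈ uIoc x y → c ≤ g r) (hw : ∀ r ∈ uIoc x y, |w r| ≤ W) :
    ∃ C, ∀ᶠ t in atTop, |∫ r in x..y, F (t * g r) * w r| ≤ C * F t := by
  obtain ⟨C, hC, h⟩ := eventually_dilation_le hpos hrv hc
  refine ⟨C * W * |y - x|, ?_⟩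
  filter_upwards [h, eventually_ge_atTop 0] with t ht ht0
  rw [← Real.norm_eq_abs]
  refine (intervalIntegral.norm_integral_le_of_norm_le_const_ae (C := C * F t * W) ?_).trans
    (le_of_eq (by ring))
  filter_upwards [hg] with r hr hmem
  rw [norm_mul, Real.norm_of_nonneg (hpos _).le, Real.norm_eq_abs]
  refine mul_le_mul (le_trans (hanti ?_) ht) (hw r hmem) (abs_nonneg _)
    (mul_nonneg hC.le (hpos t).le)
  rw [mul_comm]
  exact mul_le_mul_of_nonneg_left (hr hmem) ht0

/-- Scaling of the near-field integral under a dilation of its argument. -/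
lemma integral_near_dilation (hd : 0 < d) (hb : 0 < b) (hρ : 0 ≤ ρ) {u : ℝ} (hu : 0 < u) (t : ℝ) :
    ∫ r in 0..ρ, F (u * t * (A * r ^ b)) * (κ * r ^ (d - 1)) =
      u ^ (-((d : ℝ) / b)) *
        ∫ r in 0..(u ^ b⁻¹ * ρ), F (t * (A * r ^ b)) * (κ * r ^ (d - 1)) := by
  have hv : 0 < u ^ b⁻¹ := by positivity
  have hvb : (u ^ b⁻¹) ^ b = u := Real.rpow_inv_rpow hu.le hb.ne'
  have hvd : (u ^ b⁻¹) ^ d = u ^ ((d : ℝ) / b) := by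
    rw [← Real.rpow_natCast, ← Real.rpow_mul hu.le, inv_mul_eq_div]
  set v := u ^ b⁻¹
  have h := intervalIntegral.integral_comp_mul_left (a := 0) (b := ρ)
    (fun r => F (t * (A * r ^ b)) * (κ * r ^ (d - 1))) hv.ne'
  rw [mul_zero, smul_eq_mul, eq_comm, inv_mul_eq_iff_eq_mul₀ hv.ne'] at h
  rw [h, Real.rpow_neg hu.le, ← hvd, ← mul_assoc, ← intervalIntegral.integral_const_mul]
  refine intervalIntegral.integral_congr fun r hr => ?_
  rw [uIcc_of_le hρ] at hr
  have hpow : v ^ d = v * v ^ (d - 1) := by rw [← pow_succ', Nat.sub_add_cancel hd]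
  rw [Real.mul_rpow hv.le hr.1, hvb, mul_pow, hpow]
  have : t * (A * (u * r ^ b)) = u * t * (A * r ^ b) := by ring
  rw [this]
  field_simp

/-- The mixed tail is `d / b`-homogeneous up to an error of order `F t`. -/
lemma exists_abs_pathloss_sub_le
    (hanti : Antitone F) (hpos : ∀ x, 0 < F x) (hle : ∀ x, F x ≤ 1)
    (hrv : ∀ u > (0:ℝ), Tendsto (fun x => F (u * x) / F x) atTop (nhds (u ^ (-α))))
    (hd : 0 < d) (hA : 0 < A) (hb : 0 < b) (hc : 0 < c) (hκ : 0 < κ) (hρ : 0 < ρ) (hρD : ρ ≤ D)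
    (hl : AEMeasurable l (volume.restrict (Ioo 0 D)))
    (hnear : ∀ r, 0 < r → r < ρ → l r = A * r ^ b)
    (hfar : ∀ r, ρ ≤ r → r < D → c ≤ l r) {u : ℝ} (hu : 0 < u) :
    ∃ C, ∀ᶠ t in atTop, |(∫ r in 0..D, F (u * t * l r) * (κ * r ^ (d - 1))) -
      u ^ (-((d : ℝ) / b)) * ∫ r in 0..D, F (t * l r) * (κ * r ^ (d - 1))| ≤ C * F t := by
  have hD : 0 < D := hρ.trans_le hρD
  set v := u ^ b⁻¹ with hv
  have hvpos : 0 < v := by positivity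
  set q := u ^ (-((d : ℝ) / b)) with hq
  have hqpos : 0 < q := by positivity
  have hwbound : ∀ x y r : ℝ, 0 < x → 0 < y → r ∈ uIoc x y →
      |κ * r ^ (d - 1)| ≤ κ * max x y ^ (d - 1) := fun x y r hx hy hr => by
    have hr0 : 0 < r := (lt_min hx hy).trans hr.1
    rw [abs_of_nonneg (by positivity)]
    gcongr
    exact hr.2
  obtain ⟨C₁, h₁⟩ := eventually_abs_integral_dilation_le (g := fun r => A * r ^ b)
    (w := fun r => κ * r ^ (d - 1)) (x := ρ) (y := v * ρ) (c := A * (min ρ (v * ρ)) ^ b)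
    hanti hpos hrv (by positivity)
    (Eventually.of_forall fun r hr => by
      have h0 : 0 < min ρ (v * ρ) := by positivity
      have := hr.1.le
      gcongr) (fun r => hwbound _ _ r hρ (by positivity))
  obtain ⟨C₂, h₂⟩ := eventually_abs_integral_dilation_le (g := l)
    (w := fun r => κ * r ^ (d - 1)) (x := ρ) (y := D) hanti hpos hrv hc
    (by
      filter_upwards [compl_mem_ae_iff.2 (measure_singleton D)] with r hr hmem
      rw [uIoc_of_le hρD] at hmem
      exact hfar r hmem.1.le (lt_of_le_of_ne hmem.2 hr))
    (fun r => hwbound _ _ r hρ hD)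
  obtain ⟨C₃, -, h₃⟩ := eventually_dilation_le hpos hrv hu
  have hint : ∀ t, IntegrableOn (fun r => F (t * l r) * (κ * r ^ (d - 1))) (Ioo 0 D) :=
    integrable_dilation_mul hanti hpos hle hl (integrableOn_const_mul_pow 0 D (d - 1))
  have hsplit : ∀ t, ∫ r in 0..D, F (t * l r) * (κ * r ^ (d - 1)) =
      (∫ r in 0..ρ, F (t * (A * r ^ b)) * (κ * r ^ (d - 1))) +
        ∫ r in ρ..D, F (t * l r) * (κ * r ^ (d - 1)) := fun t => by
    rw [← intervalIntegral.integral_add_adjacent_intervals (b := ρ)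
      ((intervalIntegrable_iff_integrableOn_Ioo_of_le hρ.le).2
        ((hint t).mono_set (Ioo_subset_Ioo le_rfl hρD)))
      ((intervalIntegrable_iff_integrableOn_Ioo_of_le hρD).2
        ((hint t).mono_set (Ioo_subset_Ioo hρ.le le_rfl)))]
    congr 1
    simp_rw [intervalIntegral.integral_of_le hρ.le, integral_Ioc_eq_integral_Ioo]
    exact setIntegral_congr_fun measurableSet_Ioo fun r hr => by
      simp only [hnear r hr.1 hr.2]
  have hnearint : ∀ t x y, IntervalIntegrable
      (fun r => F (t * (A * r ^ b)) * (κ * r ^ (d - 1))) volume x y := fun t x y => by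
    rw [intervalIntegrable_iff]
    refine integrable_dilation_mul hanti hpos hle (by fun_prop) ?_ t
    exact (intervalIntegrable_iff.1
      ((by fun_prop : Continuous fun r : ℝ => κ * r ^ (d - 1)).intervalIntegrable x y))
  have hC₂ : 0 ≤ C₂ := by
    obtain ⟨t, ht⟩ := h₂.exists
    exact nonneg_of_mul_nonneg_left ((abs_nonneg _).trans ht) (hpos t)
  refine ⟨q * C₁ + C₂ * C₃ + q * C₂, ?_⟩
  filter_upwards [h₁, h₂, (tendsto_id.const_mul_atTop hu).eventually h₂, h₃]
    with t ht₁ ht₂ ht₂u ht₃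
  simp only [id] at ht₂u
  rw [hsplit, hsplit, integral_near_dilation hd hb hρ.le hu, ← hv, ← hq,
    ← intervalIntegral.integral_add_adjacent_intervals (hnearint t 0 ρ) (hnearint t ρ (v * ρ))]
  generalize (∫ r in 0..ρ, F (t * (A * r ^ b)) * (κ * r ^ (d - 1))) = N
  generalize (∫ r in ρ..v * ρ, F (t * (A * r ^ b)) * (κ * r ^ (d - 1))) = E at *
  generalize (∫ r in ρ..D, F (u * t * l r) * (κ * r ^ (d - 1))) = Hu at *
  generalize (∫ r in ρ..D, F (t * l r) * (κ * r ^ (d - 1))) = H at *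
  have e : q * (N + E) + Hu - q * (N + H) = q * E + Hu - q * H := by ring
  rw [e]
  have a1 := mul_le_mul_of_nonneg_left ht₁ hqpos.le
  have a2 := mul_le_mul_of_nonneg_left ht₂ hqpos.le
  have a3 := mul_le_mul_of_nonneg_left ht₃ hC₂
  calc |q * E + Hu - q * H| ≤ |q * E| + |Hu| + |q * H| :=
        (abs_sub _ _).trans (add_le_add_left (abs_add_le _ _) _)
    _ = q * |E| + |Hu| + q * |H| := by rw [abs_mul, abs_mul, abs_of_pos hqpos]
    _ ≤ _ := by linarith

/-- Regular variation of the mixed tail for a pathloss that is a power law in the near field and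
bounded below in the far field. -/
lemma tendsto_pathloss_ratio
    (hanti : Antitone F) (hpos : ∀ x, 0 < F x) (hle : ∀ x, F x ≤ 1)
    (hrv : ∀ u > (0:ℝ), Tendsto (fun x => F (u * x) / F x) atTop (nhds (u ^ (-α))))
    (hα : 0 ≤ α) (hd : 0 < d) (hA : 0 < A) (hb : 0 < b) (hc : 0 < c) (hκ : 0 < κ)
    (hρ : 0 < ρ) (hρD : ρ ≤ D)
    (hl : AEMeasurable l (volume.restrict (Ioo 0 D)))
    (hnear : ∀ r, 0 < r → r < ρ → l r = A * r ^ b)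
    (hfar : ∀ r, ρ ≤ r → r < D → c ≤ l r) {u : ℝ} (hu : 0 < u) :
    Tendsto (fun t => (∫ r in 0..D, F (u * t * l r) * (κ * r ^ (d - 1))) /
      ∫ r in 0..D, F (t * l r) * (κ * r ^ (d - 1))) atTop
      (nhds (u ^ (-(min ((d : ℝ) / b) α)))) := by
  rcases lt_or_ge α (d / b) with h | h
  · obtain ⟨L, hL, hlim⟩ := exists_tendsto_pathloss_div hanti hpos hle hrv hα hd hA hb hc hκ
      (hρ.trans_le hρD) hl hnear hfar h
    rw [min_eq_right h.le]
    exact tendsto_ratio_of_tendsto_div hpos hrv hL hlim hu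
  · obtain ⟨C, hC⟩ := exists_abs_pathloss_sub_le hanti hpos hle hrv hd hA hb hc hκ hρ hρD hl
      hnear hfar hu
    rw [min_eq_left h]
    exact tendsto_ratio_of_abs_sub_le hpos (tendsto_pathloss_div_atTop hanti hpos hle hrv hα hd
      hA hb hκ hρ hρD hl hnear h) hC

end TwoZone

/-- A multi-slope pathloss is measurable and, away from the near field, bounded below. -/
lemma multiSlope_aemeasurable_and_bddBelow {K : ℕ} {R β A : ℕ → ℝ} {l : ℝ → ℝ} (hR0 : R 0 = 0)
    (hRmono : ∀ k < K, R k < R (k + 1)) (hβpos : ∀ k, 1 ≤ k → k < K → 0 < β k)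
    (hApos : ∀ k < K, 0 < A k)
    (hl : ∀ k < K, ∀ r, R k ≤ r → r < R (k + 1) → l r = A k * r ^ β k) {k : ℕ}
    (hk : 1 ≤ k) (hkK : k ≤ K) :
    0 < R 1 ∧ R 1 ≤ R k ∧ AEMeasurable l (volume.restrict (Ico 0 (R k))) ∧
      ∃ c > 0, ∀ r, R 1 ≤ r → r < R k → c ≤ l r := by
  have hpiece : ∀ k < K, AEMeasurable l (volume.restrict (Ico (R k) (R (k + 1)))) := fun k hk => by
    refine AEMeasurable.congr (f := fun r => A k * r ^ β k) (by fun_prop) ?_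
    filter_upwards [ae_restrict_mem measurableSet_Ico] with r hr
    exact (hl k hk r hr.1 hr.2).symm
  induction k, hk using Nat.le_induction with
  | base =>
    have h0 := hRmono 0 hkK
    rw [hR0, zero_add] at h0
    refine ⟨h0, le_rfl, ?_, 1, one_pos, fun r h1 h2 => absurd h1 h2.not_ge⟩
    simpa [hR0] using hpiece 0 hkK
  | succ k hk ih =>
    obtain ⟨h0, h1, hmeas, c, hc, hbound⟩ := ih (Nat.le_of_succ_le hkK)
    have hRk := hRmono k hkK
    refine ⟨h0, h1.trans hRk.le, ?_, min c (A k * R k ^ β k), ?_, fun r hr hr2 => ?_⟩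
    · rw [← Ico_union_Ico_eq_Ico (h0.le.trans h1) hRk.le]
      exact aemeasurable_union_iff.2 ⟨hmeas, hpiece k hkK⟩
    · have := hApos k hkK
      have := h0.trans_le h1
      positivity
    · rcases lt_or_ge r (R k) with h | h
      · exact (min_le_left _ _).trans (hbound r hr h)
      · rw [hl k hkK r h hr2]
        refine (min_le_right _ _).trans ?_
        have := (hApos k hkK).le
        have := (hβpos k hk hkK).le
        have := (h0.trans_le h1).le
        gcongr

/-- **Theorem 1, regularly varying channel power, unbounded near field.**
In the multi-slope pathloss setup with `β₀ > 0` and `δ₀ = d/β₀`, if the channel-power tail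
`F̄_m` is everywhere positive and regularly varying at infinity with index `-α`, `α ∈ [0,∞)`,
then `F̄_P` is regularly varying at infinity with index `-min(δ₀, α)`. -/
theorem tail_received_power_regularly_varying_unbounded
    (d K : ℕ) (hd : 0 < d) (hK : 1 ≤ K)
    (R β A : ℕ → ℝ)
    (hR0 : R 0 = 0)
    (hRmono : ∀ k < K, R k < R (k + 1))
    (hβ0 : 0 < β 0)
    (hβpos : ∀ k, 1 ≤ k → k < K → 0 < β k)
    (hβmono : ∀ k, k + 1 < K → β k < β (k + 1))
    (hApos : ∀ k < K, 0 < A k)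
    (hcont : ∀ k, k + 1 < K → A k * R (k + 1) ^ β k = A (k + 1) * R (k + 1) ^ β (k + 1))
    {Ω : Type*} [MeasurableSpace Ω] (P : Measure Ω) [IsProbabilityMeasure P]
    (m : Ω → ℝ) (hm_nonneg : ∀ ω, 0 ≤ m ω) (hm_meas : Measurable m)
    (Fm : ℝ → ℝ) (hFm : ∀ x, Fm x = (P {ω | x < m ω}).toReal)
    (l : ℝ → ℝ) (hl : ∀ k < K, ∀ r, R k ≤ r → r < R (k + 1) → l r = A k * r ^ β k)
    (FP : ℝ → ℝ)
    (hFP : ∀ t, FP t =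
      ∫ r in (0:ℝ)..(R K), Fm (t * l r) * ((d : ℝ) * r ^ (d - 1) / (R K) ^ d))
    (α : ℝ) (hα : 0 ≤ α)
    (hFmpos : ∀ x, 0 < Fm x)
    (hFmrv : ∀ u > (0:ℝ), Tendsto (fun x => Fm (u * x) / Fm x) atTop (nhds (u ^ (-α)))) :
    ∀ u > (0:ℝ), Tendsto (fun t => FP (u * t) / FP t) atTop
      (nhds (u ^ (-(min ((d : ℝ) / β 0) α)))) := by
  obtain ⟨hρ, hρD, hmeas, c, hc, hfar⟩ :=
    multiSlope_aemeasurable_and_bddBelow hR0 hRmono hβpos hApos hl hK le_rfl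
  have hanti : Antitone Fm := fun x y hxy => by
    rw [hFm, hFm]
    exact measureReal_mono fun ω hω => lt_of_le_of_lt hxy hω
  have hle : ∀ x, Fm x ≤ 1 := fun x => by
    rw [hFm]
    exact measureReal_le_one
  have hFP' : ∀ t, FP t =
      ∫ r in 0..(R K), Fm (t * l r) * ((d : ℝ) / R K ^ d * r ^ (d - 1)) := fun t => by
    simp_rw [hFP, mul_div_right_comm]
  have hκ : 0 < (d : ℝ) / R K ^ d :=
    div_pos (Nat.cast_pos.2 hd) (pow_pos (hρ.trans_le hρD) d)
  intro u hu
  simp_rw [hFP']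
  refine tendsto_pathloss_ratio hanti hFmpos hle hFmrv hα hd (hApos 0 hK) hβ0 hc hκ hρ hρD
    (hmeas.mono_set Ioo_subset_Ico_self) (fun r hr hr1 => ?_) hfar hu
  exact hl 0 hK r (hR0.trans_le hr.le) (by simpa using hr1)
end

section
/- (Theorem 1, regularly varying channel power, bounded near field) Consider the multi-slope pathloss setup with β₀ = 0. Suppose F̄_m(x) > 0 for all x and F̄_m is regularly varying at infinity with index -α for some α ∈ [0,∞). Then F̄_P is regularly varying at infinity with index -α, i.e. for every u > 0, F̄_P(ut)/F̄_P(t) → u^{-α} as t → ∞. -/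
open MeasureTheory Filter Real Set

/-- If `F` is positive, antitone and regularly varying with index `-α`, and `g` is bounded below
by a positive constant, then the mixture `t ↦ ∫ F (t * g x) * w x`, normalised by `F t`,
converges to `∫ g x ^ (-α) * w x`. -/
theorem tendsto_integral_div_of_regularly_varying {X : Type*} [MeasurableSpace X]
    {μ : Measure X} {F : ℝ → ℝ} {α c : ℝ} {g w : X → ℝ}
    (hF : Antitone F) (hFpos : ∀ x, 0 < F x)
    (hFrv : ∀ u > (0:ℝ), Tendsto (fun x => F (u * x) / F x) atTop (nhds (u ^ (-α))))
    (hg : AEMeasurable g μ) (hc : 0 < c) (hcg : ∀ᵐ x ∂μ, c ≤ g x) (hw : Integrable w μ) :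
    Tendsto (fun t => (∫ x, F (t * g x) * w x ∂μ) / F t) atTop
      (nhds (∫ x, g x ^ (-α) * w x ∂μ)) := by
  simp_rw [← integral_div]
  refine tendsto_integral_filter_of_dominated_convergence
    (fun x => (c ^ (-α) + 1) * ‖w x‖) ?_ ?_ (hw.norm.const_mul _) ?_
  · refine Eventually.of_forall fun t => ?_
    exact (((hF.measurable.comp_aemeasurable (hg.const_mul t)).aestronglyMeasurable.mul
      hw.aestronglyMeasurable).aemeasurable.div_const _).aestronglyMeasurable
  · filter_upwards [(hFrv c hc).eventually_le_const (lt_add_one _), eventually_gt_atTop 0]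
      with t ht ht0
    filter_upwards [hcg] with x hx
    rw [mul_div_right_comm, norm_mul, Real.norm_of_nonneg (div_pos (hFpos _) (hFpos _)).le]
    refine mul_le_mul_of_nonneg_right (le_trans ?_ ht) (norm_nonneg _)
    refine div_le_div_of_nonneg_right (hF ?_) (hFpos t).le
    rw [mul_comm]
    exact mul_le_mul_of_nonneg_left hx ht0.le
  · filter_upwards [hcg] with x hx
    simp_rw [mul_div_right_comm, mul_comm _ (g x)]
    exact (hFrv _ (hc.trans_le hx)).mul_const _

/-- Mixtures of a regularly varying antitone function over scales bounded away from zero are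
regularly varying with the same index. -/
theorem integral_mixture_regularly_varying {X : Type*} [MeasurableSpace X]
    {μ : Measure X} [NeZero μ] {F : ℝ → ℝ} {α c : ℝ} {g w : X → ℝ}
    (hF : Antitone F) (hFpos : ∀ x, 0 < F x) (hα : 0 ≤ α)
    (hFrv : ∀ u > (0:ℝ), Tendsto (fun x => F (u * x) / F x) atTop (nhds (u ^ (-α))))
    (hg : AEMeasurable g μ) (hc : 0 < c) (hcg : ∀ᵐ x ∂μ, c ≤ g x) (hw : Integrable w μ)
    (hwpos : ∀ᵐ x ∂μ, 0 < w x) {u : ℝ} (hu : 0 < u) :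
    Tendsto (fun t => (∫ x, F (u * t * g x) * w x ∂μ) / ∫ x, F (t * g x) * w x ∂μ) atTop
      (nhds (u ^ (-α))) := by
  have hlim := tendsto_integral_div_of_regularly_varying hF hFpos hFrv hg hc hcg hw
  have hpos : ∀ᵐ x ∂μ, 0 < g x ^ (-α) * w x := by
    filter_upwards [hcg, hwpos] with x hx hwx
    exact mul_pos (Real.rpow_pos_of_pos (hc.trans_le hx) _) hwx
  have hint : Integrable (fun x => g x ^ (-α) * w x) μ := by
    refine hw.bdd_mul (c := c ^ (-α)) (hg.pow_const _).aestronglyMeasurable ?_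
    filter_upwards [hcg] with x hx
    rw [Real.norm_of_nonneg (Real.rpow_nonneg (hc.trans_le hx).le _)]
    exact Real.rpow_le_rpow_of_nonpos hc hx (neg_nonpos.2 hα)
  have hne : ∫ x, g x ^ (-α) * w x ∂μ ≠ 0 := by
    intro h0
    rw [integral_eq_zero_iff_of_nonneg_ae (hpos.mono fun x hx => hx.le) hint] at h0
    obtain ⟨x, hx, hx0⟩ := (hpos.and h0).exists
    exact hx.ne' hx0
  have hscaled := hlim.comp (tendsto_id.const_mul_atTop hu)
  have hquot := (hscaled.mul (hFrv u hu)).div hlim hne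
  rw [mul_div_cancel_left₀ _ hne] at hquot
  refine hquot.congr fun t => ?_
  have h1 := (hFpos t).ne'
  have h2 := (hFpos (u * t)).ne'
  simp only [Function.comp_apply, id, Pi.div_apply]
  rw [div_mul_div_cancel₀ h2, div_div_div_cancel_right₀ h1]

/-- A multi-slope pathloss function with constant first piece is measurable and bounded away from
zero on its domain. -/
theorem pathloss_aemeasurable_and_bounded_below {K : ℕ} {R β A : ℕ → ℝ} {l : ℝ → ℝ}
    (hR0 : R 0 = 0) (hRmono : ∀ k < K, R k < R (k + 1)) (hβ0 : β 0 = 0)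
    (hβpos : ∀ k, 1 ≤ k → k < K → 0 < β k) (hApos : ∀ k < K, 0 < A k)
    (hl : ∀ k < K, ∀ r, R k ≤ r → r < R (k + 1) → l r = A k * r ^ β k) :
    ∀ n ≤ K, 0 ≤ R n ∧ (n ≠ 0 → 0 < R n) ∧ AEMeasurable l (volume.restrict (Ico 0 (R n))) ∧
      ∃ c > 0, ∀ r ∈ Ico 0 (R n), c ≤ l r := by
  intro n
  induction n with
  | zero => exact fun _ => by simpa [hR0] using ⟨1, one_pos⟩
  | succ k ih =>
    intro hk
    obtain ⟨hR, hRpos, hmeas, c, hc, hcl⟩ := ih (by omega)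
    have hlt := hRmono k hk
    have hpiece : ∀ r ∈ Ico (R k) (R (k + 1)), l r = A k * r ^ β k :=
      fun r hr => hl k hk r hr.1 hr.2
    have hβ : 0 ≤ β k := by
      rcases Nat.eq_zero_or_pos k with rfl | h
      · exact hβ0.ge
      · exact (hβpos k h hk).le
    have hpow : 0 < R k ^ β k := by
      rcases eq_or_ne k 0 with rfl | h
      · simp [hβ0]
      · exact Real.rpow_pos_of_pos (hRpos h) _
    refine ⟨(hR.trans_lt hlt).le, fun _ => hR.trans_lt hlt, ?_,
      min c (A k * R k ^ β k), lt_min hc (mul_pos (hApos k hk) hpow), ?_⟩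
    · rw [← Ico_union_Ico_eq_Ico hR hlt.le, aemeasurable_union_iff]
      refine ⟨hmeas, AEMeasurable.congr (f := fun r => A k * r ^ β k) (by fun_prop) ?_⟩
      filter_upwards [ae_restrict_mem measurableSet_Ico] with r hr
      exact (hpiece r hr).symm
    · intro r hr
      rcases lt_or_ge r (R k) with h | h
      · exact (min_le_left _ _).trans (hcl r ⟨hr.1, h⟩)
      · rw [hpiece r ⟨h, hr.2⟩]
        exact (min_le_right _ _).trans (mul_le_mul_of_nonneg_left
          (Real.rpow_le_rpow hR h hβ) (hApos k hk).le)

/-- **Theorem 1, regularly varying channel power, bounded near field.**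
In the multi-slope pathloss setup with `β₀ = 0`, if the channel-power tail
`F̄_m` is everywhere positive and regularly varying at infinity with index `-α`, `α ∈ [0,∞)`,
then `F̄_P` is regularly varying at infinity with index `-α`. -/
theorem tail_received_power_regularly_varying_bounded
    (d K : ℕ) (hd : 0 < d) (hK : 1 ≤ K)
    (R β A : ℕ → ℝ)
    (hR0 : R 0 = 0)
    (hRmono : ∀ k < K, R k < R (k + 1))
    (hβ0 : β 0 = 0)
    (hβpos : ∀ k, 1 ≤ k → k < K → 0 < β k)
    (hβmono : ∀ k, k + 1 < K → β k < β (k + 1))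
    (hApos : ∀ k < K, 0 < A k)
    (hcont : ∀ k, k + 1 < K → A k * R (k + 1) ^ β k = A (k + 1) * R (k + 1) ^ β (k + 1))
    {Ω : Type*} [MeasurableSpace Ω] (P : Measure Ω) [IsProbabilityMeasure P]
    (m : Ω → ℝ) (hm_nonneg : ∀ ω, 0 ≤ m ω) (hm_meas : Measurable m)
    (Fm : ℝ → ℝ) (hFm : ∀ x, Fm x = (P {ω | x < m ω}).toReal)
    (l : ℝ → ℝ) (hl : ∀ k < K, ∀ r, R k ≤ r → r < R (k + 1) → l r = A k * r ^ β k)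
    (FP : ℝ → ℝ)
    (hFP : ∀ t, FP t =
      ∫ r in (0:ℝ)..(R K), Fm (t * l r) * ((d : ℝ) * r ^ (d - 1) / (R K) ^ d))
    (α : ℝ) (hα : 0 ≤ α)
    (hFmpos : ∀ x, 0 < Fm x)
    (hFmrv : ∀ u > (0:ℝ), Tendsto (fun x => Fm (u * x) / Fm x) atTop (nhds (u ^ (-α)))) :
    ∀ u > (0:ℝ), Tendsto (fun t => FP (u * t) / FP t) atTop
      (nhds (u ^ (-α))) := by
  intro u hu
  obtain ⟨-, hRpos, hmeas, c, hc, hcl⟩ :=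
    pathloss_aemeasurable_and_bounded_below hR0 hRmono hβ0 hβpos hApos hl K le_rfl
  have hRK : 0 < R K := hRpos (by omega)
  have hanti : Antitone Fm := fun x y hxy => by
    rw [hFm, hFm]
    exact ENNReal.toReal_mono (measure_ne_top _ _)
      (measure_mono fun ω (hω : y < m ω) => hxy.trans_lt hω)
  have : NeZero (volume.restrict (Ioo 0 (R K))) := ⟨by simp [Measure.restrict_eq_zero, hRK]⟩
  simp_rw [hFP, intervalIntegral.integral_of_le hRK.le, integral_Ioc_eq_integral_Ioo]
  refine integral_mixture_regularly_varying hanti hFmpos hα hFmrv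
    (hmeas.mono_measure (Measure.restrict_mono Ioo_subset_Ico_self le_rfl)) hc ?_ ?_ ?_ hu
  · filter_upwards [ae_restrict_mem measurableSet_Ioo] with r hr
    exact hcl r (Ioo_subset_Ico_self hr)
  · exact (Continuous.integrableOn_Icc (by fun_prop)).mono_set Ioo_subset_Icc_self
  · filter_upwards [ae_restrict_mem measurableSet_Ioo] with r hr
    have hr0 : 0 < r := hr.1
    positivity
end

section
/- (Theorem 1, light-tailed channel power, unbounded near field) Consider the multi-slope pathloss setup with β₀ > 0 and set δ₀ = d/β₀. Suppose P(m > 0) > 0 and there exists a positive non-increasing function H̄ on (0,∞), rapidly varying at infinity, such that F̄_m(x) ≤ H̄(x) for all sufficiently large x. Then E[m^{δ₀}] is finite and positive, and t^{δ₀} · F̄_P(t) → E[m^{δ₀}] / (A₀^{δ₀} R∞^d) as t → ∞; in particular F̄_P is regularly varying at infinity with index -δ₀. -/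
open MeasureTheory Filter Real Set

open scoped Topology

/-- A non-increasing rapidly varying function decays faster than any power. -/
lemma isBigO_rpow_neg_of_rapidly_varying {H : ℝ → ℝ} (hpos : ∀ x > 0, 0 < H x)
    (hanti : AntitoneOn H (Ioi 0))
    (hrapid : Tendsto (fun x => H (2 * x) / H x) atTop (𝓝 0)) {p : ℝ} (hp : 0 < p) :
    H =O[atTop] fun x => x ^ (-p) := by
  have hq : (0 : ℝ) < 2 ^ (-p) := rpow_pos_of_pos two_pos _
  obtain ⟨x₀, hx₀⟩ := eventually_atTop.1 (hrapid.eventually_lt_const hq)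
  set a := max x₀ 1 with ha
  have ha1 : 1 ≤ a := le_max_right _ _
  have ha0 : 0 < a := by linarith
  have hstep : ∀ x ≥ a, H (2 * x) ≤ 2 ^ (-p) * H x := fun x hx =>
    ((div_lt_iff₀ (hpos x (by linarith))).1 (hx₀ x ((le_max_left _ _).trans hx))).le
  have hdyadic : ∀ n : ℕ, H (2 ^ n * a) ≤ (2 ^ n) ^ (-p) * H a := by
    intro n
    induction n with
    | zero => simp
    | succ n ih =>
      have hle : a ≤ 2 ^ n * a := le_mul_of_one_le_left ha0.le (one_le_pow₀ one_le_two)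
      calc H (2 ^ (n + 1) * a) = H (2 * (2 ^ n * a)) := by ring_nf
        _ ≤ 2 ^ (-p) * H (2 ^ n * a) := hstep _ hle
        _ ≤ 2 ^ (-p) * ((2 ^ n) ^ (-p) * H a) := by gcongr
        _ = (2 ^ (n + 1)) ^ (-p) * H a := by
          rw [pow_succ', mul_rpow two_pos.le (by positivity), mul_assoc]
  refine Asymptotics.IsBigO.of_bound ((2 * a) ^ p * H a) ?_
  filter_upwards [eventually_ge_atTop a] with x hx
  have hx0 : 0 < x := by linarith
  obtain ⟨n, hn, hn'⟩ := exists_nat_pow_near ((one_le_div ha0).2 hx) one_lt_two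
  rw [le_div_iff₀ ha0] at hn
  rw [div_lt_iff₀ ha0] at hn'
  rw [norm_of_nonneg (hpos x hx0).le, norm_of_nonneg (rpow_nonneg hx0.le _)]
  have hHa := hpos a ha0
  have hpow : ((2 : ℝ) ^ n) ^ (-p) ≤ (x / (2 * a)) ^ (-p) := by
    refine rpow_le_rpow_of_nonpos (by positivity) ?_ (by linarith)
    rw [div_le_iff₀ (by positivity)]
    rw [pow_succ] at hn'
    linarith
  calc H x ≤ H (2 ^ n * a) := hanti (by simp; positivity) hx0 hn
    _ ≤ (2 ^ n) ^ (-p) * H a := hdyadic n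
    _ ≤ (x / (2 * a)) ^ (-p) * H a := by gcongr
    _ = (2 * a) ^ p * H a * x ^ (-p) := by
      rw [div_rpow hx0.le (by positivity), rpow_neg (by positivity : 0 ≤ 2 * a)]
      field_simp

section Tail

variable {Ω : Type*} [MeasurableSpace Ω] {P : Measure Ω}

lemma antitone_measureReal_lt [IsFiniteMeasure P] (m : Ω → ℝ) :
    Antitone fun x => P.real {ω | x < m ω} := fun _ _ h =>
  measureReal_mono fun _ hω => lt_of_le_of_lt h hω

/-- A nonnegative random variable whose tail decays faster than a power larger than `δ` has a
finite moment of order `δ`. -/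
lemma integrable_rpow_of_tail_isBigO [IsProbabilityMeasure P] {m : Ω → ℝ}
    (hm_nonneg : ∀ ω, 0 ≤ m ω) (hm_meas : Measurable m) {δ a : ℝ} (hδ : 0 < δ) (hδa : δ < a)
    (htail : (fun x => P.real {ω | x < m ω}) =O[atTop] fun x => x ^ (-a)) :
    Integrable (fun ω => m ω ^ δ) P := by
  have hint : IntegrableOn (fun t => t ^ (δ - 1) * P.real {ω | t < m ω}) (Ioi 0) := by
    refine mellin_convergent_of_isBigO_scalar (a := a) (b := 0)
      (((antitone_measureReal_lt m).locallyIntegrable).locallyIntegrableOn _) htail hδa ?_ hδ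
    refine Asymptotics.IsBigO.of_bound 1 (Eventually.of_forall fun x => ?_)
    simp [abs_of_nonneg]
  refine ⟨(hm_meas.pow_const δ).aestronglyMeasurable, ?_⟩
  rw [hasFiniteIntegral_iff_ofReal (Eventually.of_forall fun ω => rpow_nonneg (hm_nonneg ω) _),
    lintegral_rpow_eq_lintegral_meas_lt_mul P (Eventually.of_forall hm_nonneg)
      hm_meas.aemeasurable hδ]
  refine ENNReal.mul_lt_top ENNReal.ofReal_lt_top ?_
  convert hint.lintegral_lt_top using 1
  refine setLIntegral_congr_fun measurableSet_Ioi fun t ht => ?_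
  rw [ENNReal.ofReal_mul (rpow_nonneg (le_of_lt ht) _), mul_comm, ofReal_measureReal]

/-- Layer-cake formula for the radial integral of the tail of a random variable. -/
lemma radial_integral_tail [IsProbabilityMeasure P] {m : Ω → ℝ}
    (hm_nonneg : ∀ ω, 0 ≤ m ω) (hm_meas : Measurable m) {d : ℕ} (hd : 0 < d) {b c : ℝ}
    (hb : 0 < b) (hc : 0 < c) (hint : Integrable (fun ω => m ω ^ ((d : ℝ) / b)) P) :
    IntegrableOn (fun s => P.real {ω | c * s ^ b < m ω} * (d * s ^ (d - 1))) (Ioi 0) ∧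
      ∫ s in Ioi 0, P.real {ω | c * s ^ b < m ω} * (d * s ^ (d - 1)) =
        (∫ ω, m ω ^ ((d : ℝ) / b) ∂P) / c ^ ((d : ℝ) / b) := by
  set X : Ω → ℝ := fun ω => (m ω / c) ^ b⁻¹ with hX
  have hX_nonneg : ∀ ω, 0 ≤ X ω := fun ω => rpow_nonneg (div_nonneg (hm_nonneg ω) hc.le) _
  have hXm : Measurable X := (hm_meas.div_const c).pow_const _
  have hXpow : ∀ ω, X ω ^ (d : ℝ) = m ω ^ ((d : ℝ) / b) / c ^ ((d : ℝ) / b) := fun ω => by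
    rw [hX, ← rpow_mul (div_nonneg (hm_nonneg ω) hc.le), inv_mul_eq_div,
      div_rpow (hm_nonneg ω) hc.le]
  have hset : ∀ s ∈ Ioi (0 : ℝ), {ω | s < X ω} = {ω | c * s ^ b < m ω} := fun s hs => by
    ext ω
    simp only [mem_ofPred_eq, hX]
    rw [lt_rpow_inv_iff_of_pos (le_of_lt hs) (div_nonneg (hm_nonneg ω) hc.le) hb,
      lt_div_iff₀ hc, mul_comm]
  have hcake := lintegral_rpow_eq_lintegral_meas_lt_mul P (Eventually.of_forall hX_nonneg)
    hXm.aemeasurable (Nat.cast_pos.2 hd : (0 : ℝ) < d)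
  have hlint : ∫⁻ s in Ioi 0, ENNReal.ofReal
      (P.real {ω | c * s ^ b < m ω} * (d * s ^ (d - 1))) =
        ∫⁻ ω, ENNReal.ofReal (X ω ^ (d : ℝ)) ∂P := by
    rw [hcake, ← lintegral_const_mul' _ _ ENNReal.ofReal_ne_top]
    refine setLIntegral_congr_fun measurableSet_Ioi fun s hs => ?_
    have hexp : s ^ ((d : ℝ) - 1) = s ^ (d - 1) := by
      rw [← Nat.cast_pred hd, rpow_natCast]
    rw [hset s hs, hexp, ENNReal.ofReal_mul measureReal_nonneg,
      ENNReal.ofReal_mul (Nat.cast_nonneg d), ofReal_measureReal]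
    ring
  have hmeas : Measurable fun s : ℝ => P.real {ω | c * s ^ b < m ω} * (d * s ^ (d - 1)) :=
    ((antitone_measureReal_lt m).measurable.comp
      ((measurable_id.pow_const b).const_mul c)).mul ((measurable_id.pow_const _).const_mul _)
  have hnonneg : 0 ≤ᵐ[volume.restrict (Ioi 0)]
      fun s : ℝ => P.real {ω | c * s ^ b < m ω} * (d * s ^ (d - 1)) := by
    filter_upwards [ae_restrict_mem measurableSet_Ioi] with s hs
    have : (0 : ℝ) < s := hs
    simp only [Pi.zero_apply]
    positivity
  have hXint : Integrable (fun ω => X ω ^ (d : ℝ)) P := by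
    simp_rw [hXpow]
    exact hint.div_const _
  have hX0 : 0 ≤ᵐ[P] fun ω => X ω ^ (d : ℝ) :=
    Eventually.of_forall fun ω => rpow_nonneg (hX_nonneg ω) _
  refine ⟨⟨hmeas.aestronglyMeasurable, ?_⟩, ?_⟩
  · rw [hasFiniteIntegral_iff_ofReal hnonneg, hlint]
    exact hXint.lintegral_lt_top
  · rw [integral_eq_lintegral_of_nonneg_ae hnonneg hmeas.aestronglyMeasurable, hlint,
      ← integral_eq_lintegral_of_nonneg_ae hX0 hXint.aestronglyMeasurable]
    simp_rw [hXpow]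
    exact integral_div _ _

/-- If the pathloss `l` equals `a * r ^ b` near the origin and is at least `c * r ^ b` up to the
cell radius `ρ`, the tail of the received power is asymptotically a power law. -/
lemma tendsto_rpow_mul_integral_tail [IsProbabilityMeasure P] {m : Ω → ℝ}
    (hm_nonneg : ∀ ω, 0 ≤ m ω) (hm_meas : Measurable m) {d : ℕ} (hd : 0 < d) {a b c ρ ρ₁ : ℝ}
    (ha : 0 < a) (hb : 0 < b) (hc : 0 < c) (hρ : 0 < ρ) (hρ₁ : 0 < ρ₁)
    (hint : Integrable (fun ω => m ω ^ ((d : ℝ) / b)) P) {l : ℝ → ℝ} (hl_meas : Measurable l)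
    (hl_near : ∀ r, 0 < r → r < ρ₁ → l r = a * r ^ b)
    (hl_lower : ∀ r, 0 < r → r < ρ → c * r ^ b ≤ l r) :
    Tendsto (fun t : ℝ => t ^ ((d : ℝ) / b) *
        ∫ r in (0 : ℝ)..ρ, P.real {ω | t * l r < m ω} * (d * r ^ (d - 1) / ρ ^ d)) atTop
      (𝓝 ((∫ ω, m ω ^ ((d : ℝ) / b) ∂P) / (a ^ ((d : ℝ) / b) * ρ ^ d))) := by
  set F : ℝ → ℝ → ℝ := fun t s => (Iio ρ).indicator
    (fun r => P.real {ω | t * l r < m ω}) (t ^ (-b⁻¹) * s) * (d * s ^ (d - 1)) / ρ ^ d with hF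
  have htail := antitone_measureReal_lt (P := P) m
  have hscale : ∀ t : ℝ, 0 < t → t * (t ^ (-b⁻¹)) ^ b = 1 := fun t ht => by
    rw [← rpow_mul ht.le, neg_mul, inv_mul_cancel₀ hb.ne', rpow_neg_one,
      mul_inv_cancel₀ ht.ne']
  have hrescale : ∀ t : ℝ, 0 < t → ∫ s in Ioi 0, F t s = t ^ ((d : ℝ) / b) *
      ∫ r in (0 : ℝ)..ρ, P.real {ω | t * l r < m ω} * (d * r ^ (d - 1) / ρ ^ d) := by
    intro t ht
    set q := t ^ (-b⁻¹) with hq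
    have hq0 : 0 < q := rpow_pos_of_pos ht _
    have htq : t ^ ((d : ℝ) / b) * q ^ d = 1 := by
      rw [hq, ← rpow_natCast, ← rpow_mul ht.le, ← rpow_add ht]
      convert rpow_zero t using 2
      ring
    have hqd : q ^ d = q * q ^ (d - 1) := (mul_pow_sub_one hd.ne' q).symm
    have hcov := integral_comp_mul_left_Ioi ((Iio ρ).indicator fun r : ℝ =>
      P.real {ω | t * l r < m ω} * (d * r ^ (d - 1) / ρ ^ d)) 0 hq0
    rw [mul_zero, setIntegral_indicator measurableSet_Iio, Ioi_inter_Iio,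
      ← integral_Ioc_eq_integral_Ioo, ← intervalIntegral.integral_of_le hρ.le,
      smul_eq_mul, eq_inv_mul_iff_mul_eq₀ hq0.ne'] at hcov
    rw [← hcov, ← integral_const_mul, ← integral_const_mul]
    refine integral_congr_ae (Eventually.of_forall fun s => ?_)
    by_cases hs : q * s ∈ Iio ρ
    · simp only [hF, ← hq, indicator_of_mem hs]
      rw [mul_pow]
      rw [hqd] at htq
      linear_combination (-(P.real {ω | t * l (q * s) < m ω} * (d * s ^ (d - 1)) / ρ ^ d)) * htq
    · simp only [hF, ← hq, indicator_of_notMem hs]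
      ring
  have hlim : (∫ ω, m ω ^ ((d : ℝ) / b) ∂P) / (a ^ ((d : ℝ) / b) * ρ ^ d) =
      ∫ s in Ioi 0, P.real {ω | a * s ^ b < m ω} * (d * s ^ (d - 1)) / ρ ^ d := by
    rw [integral_div, (radial_integral_tail hm_nonneg hm_meas hd hb ha hint).2, div_div]
  rw [hlim]
  refine Tendsto.congr' (f₁ := fun t => ∫ s in Ioi 0, F t s) ?_ ?_
  · filter_upwards [eventually_gt_atTop 0] with t ht using hrescale t ht
  refine tendsto_integral_filter_of_dominated_convergence
    (fun s => P.real {ω | c * s ^ b < m ω} * (d * s ^ (d - 1)) / ρ ^ d) ?_ ?_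
    ((radial_integral_tail hm_nonneg hm_meas hd hb hc hint).1.div_const _) ?_
  · refine Eventually.of_forall fun t => Measurable.aestronglyMeasurable ?_
    have hind : Measurable ((Iio ρ).indicator fun r => P.real {ω | t * l r < m ω}) :=
      (htail.measurable.comp (hl_meas.const_mul t)).indicator measurableSet_Iio
    exact ((hind.comp (measurable_id.const_mul _)).mul
      ((measurable_id.pow_const _).const_mul _)).div_const _
  · filter_upwards [eventually_gt_atTop 0] with t ht
    filter_upwards [ae_restrict_mem measurableSet_Ioi] with s hs
    have hs0 : (0 : ℝ) < s := hs
    have hq0 : 0 < t ^ (-b⁻¹) := rpow_pos_of_pos ht _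
    have hind : 0 ≤ (Iio ρ).indicator (fun r => P.real {ω | t * l r < m ω}) (t ^ (-b⁻¹) * s) :=
      indicator_nonneg (fun _ _ => measureReal_nonneg) _
    rw [norm_of_nonneg (by positivity)]
    simp only [hF]
    gcongr
    refine indicator_apply_le' (fun hmem => htail ?_) fun _ => measureReal_nonneg
    calc c * s ^ b = t * (c * (t ^ (-b⁻¹) * s) ^ b) := by
          rw [mul_rpow hq0.le hs0.le]
          linear_combination (-(c * s ^ b)) * hscale t ht
      _ ≤ t * l (t ^ (-b⁻¹) * s) := by
          gcongr
          exact hl_lower _ (by positivity) hmem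
  · filter_upwards [ae_restrict_mem measurableSet_Ioi] with s hs
    have hs0 : (0 : ℝ) < s := hs
    have hto : Tendsto (fun t : ℝ => t ^ (-b⁻¹) * s) atTop (𝓝 0) := by
      simpa using (tendsto_rpow_neg_atTop (inv_pos.2 hb)).mul_const s
    refine tendsto_const_nhds.congr' ?_
    filter_upwards [eventually_gt_atTop 0, hto.eventually_lt_const hρ,
      hto.eventually_lt_const hρ₁] with t ht h h₁
    have hq0 : 0 < t ^ (-b⁻¹) := rpow_pos_of_pos ht _
    have hval : t * l (t ^ (-b⁻¹) * s) = a * s ^ b := by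
      rw [hl_near _ (by positivity) h₁, mul_rpow hq0.le hs0.le]
      linear_combination (a * s ^ b) * hscale t ht
    simp only [hF]
    rw [indicator_of_mem (show _ ∈ Iio ρ from h), hval]

end Tail

/-- A power-law limit `t ^ δ * f t → L > 0` makes `f` regularly varying with index `-δ`. -/
lemma tendsto_div_of_tendsto_rpow_mul {f : ℝ → ℝ} {δ L : ℝ} (hL : 0 < L)
    (hf : Tendsto (fun t => t ^ δ * f t) atTop (𝓝 L)) {u : ℝ} (hu : 0 < u) :
    Tendsto (fun t => f (u * t) / f t) atTop (𝓝 (u ^ (-δ))) := by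
  have hcomp : Tendsto (fun t => (u * t) ^ δ * f (u * t)) atTop (𝓝 L) :=
    hf.comp (tendsto_id.const_mul_atTop hu)
  have hquot := (hcomp.div hf hL.ne').const_mul (u ^ (-δ))
  rw [div_self hL.ne', mul_one] at hquot
  refine hquot.congr' ?_
  filter_upwards [eventually_gt_atTop 0] with t ht
  have hut := (rpow_pos_of_pos hu δ).ne'
  have htt := (rpow_pos_of_pos ht δ).ne'
  simp only [Pi.div_apply]
  rw [mul_rpow hu.le ht.le, rpow_neg hu.le, mul_assoc, mul_left_comm (u ^ δ),
    mul_div_mul_left _ _ htt, mul_div_assoc, inv_mul_cancel_left₀ hut]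

/-- A multi-slope pathloss function agrees on the cell with a measurable function and dominates
a multiple of the near-field power law. -/
lemma multislope_measurable_and_lower_bound {K : ℕ} {R β A : ℕ → ℝ} {l : ℝ → ℝ}
    (hR0 : R 0 = 0) (hRmono : ∀ k < K, R k < R (k + 1)) (hβ0 : 0 < β 0)
    (hβpos : ∀ k, 1 ≤ k → k < K → 0 < β k) (hApos : ∀ k < K, 0 < A k)
    (hl : ∀ k < K, ∀ r, R k ≤ r → r < R (k + 1) → l r = A k * r ^ β k)
    {n : ℕ} (hn : 1 ≤ n) (hnK : n ≤ K) :
    0 < R n ∧ ∃ g : ℝ → ℝ, Measurable g ∧ (∀ r, 0 ≤ r → r < R n → l r = g r) ∧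
      ∃ c > 0, ∀ r, 0 < r → r < R n → c * r ^ β 0 ≤ l r := by
  induction n, hn using Nat.le_induction with
  | base =>
    have hlr : ∀ r, 0 ≤ r → r < R 1 → l r = A 0 * r ^ β 0 := fun r h h' =>
      hl 0 hnK r (hR0.trans_le h) h'
    exact ⟨hR0 ▸ hRmono 0 hnK, fun r => A 0 * r ^ β 0,
      (measurable_id.pow_const _).const_mul _, hlr, A 0, hApos 0 hnK,
      fun r h h' => (hlr r h.le h').ge⟩
  | succ n hn ih =>
    have hnK' : n < K := hnK
    obtain ⟨hRn, g, hg, hlg, c, hc, hcl⟩ := ih hnK'.le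
    have hRn' : 0 < R (n + 1) := hRn.trans (hRmono n hnK')
    have hAn := hApos n hnK'
    have hc' : 0 < A n * R n ^ β n / R (n + 1) ^ β 0 := by positivity
    refine ⟨hRn', fun r => if r < R n then g r else A n * r ^ β n,
      Measurable.ite measurableSet_Iio hg ((measurable_id.pow_const _).const_mul _), ?_,
      min c (A n * R n ^ β n / R (n + 1) ^ β 0), lt_min hc hc', ?_⟩
    · intro r hr hr'
      beta_reduce
      split_ifs with h
      · exact hlg r hr h
      · exact hl n hnK' r (not_lt.1 h) hr'
    · intro r hr hr'
      rcases lt_or_ge r (R n) with h | h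
      · exact le_trans (by gcongr; exact min_le_left _ _) (hcl r hr h)
      · rw [hl n hnK' r h hr']
        have hβn := hβpos n hn hnK'
        calc min c (A n * R n ^ β n / R (n + 1) ^ β 0) * r ^ β 0
            ≤ A n * R n ^ β n / R (n + 1) ^ β 0 * R (n + 1) ^ β 0 := by
              gcongr
              exact min_le_right _ _
          _ = A n * R n ^ β n := div_mul_cancel₀ _ (rpow_pos_of_pos hRn' _).ne'
          _ ≤ A n * r ^ β n := by gcongr

/-- **Theorem 1, light-tailed channel power, unbounded near field.**
In the multi-slope pathloss setup with `β₀ > 0`, `δ₀ = d/β₀`, if `P(m > 0) > 0` and the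
channel-power tail `F̄_m` is eventually dominated by a positive non-increasing rapidly varying
function `H̄`, then `E[m^{δ₀}]` is finite and positive,
`t^{δ₀} F̄_P(t) → E[m^{δ₀}] / (A₀^{δ₀} R∞^d)` as `t → ∞`, and in particular `F̄_P` is
regularly varying at infinity with index `-δ₀`. -/
theorem tail_received_power_light_tail_unbounded
    (d K : ℕ) (hd : 0 < d) (hK : 1 ≤ K)
    (R β A : ℕ → ℝ)
    (hR0 : R 0 = 0)
    (hRmono : ∀ k < K, R k < R (k + 1))
    (hβ0 : 0 < β 0)
    (hβpos : ∀ k, 1 ≤ k → k < K → 0 < β k)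
    (hβmono : ∀ k, k + 1 < K → β k < β (k + 1))
    (hApos : ∀ k < K, 0 < A k)
    (hcont : ∀ k, k + 1 < K → A k * R (k + 1) ^ β k = A (k + 1) * R (k + 1) ^ β (k + 1))
    {Ω : Type*} [MeasurableSpace Ω] (P : Measure Ω) [IsProbabilityMeasure P]
    (m : Ω → ℝ) (hm_nonneg : ∀ ω, 0 ≤ m ω) (hm_meas : Measurable m)
    (hm_pos : 0 < P {ω | 0 < m ω})
    (Fm : ℝ → ℝ) (hFm : ∀ x, Fm x = (P {ω | x < m ω}).toReal)
    (l : ℝ → ℝ) (hl : ∀ k < K, ∀ r, R k ≤ r → r < R (k + 1) → l r = A k * r ^ β k)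
    (FP : ℝ → ℝ)
    (hFP : ∀ t, FP t =
      ∫ r in (0:ℝ)..(R K), Fm (t * l r) * ((d : ℝ) * r ^ (d - 1) / (R K) ^ d))
    (Hbar : ℝ → ℝ)
    (hHpos : ∀ x > 0, 0 < Hbar x)
    (hHanti : AntitoneOn Hbar (Set.Ioi 0))
    (hHrapid : ∀ u > (1:ℝ), Tendsto (fun x => Hbar (u * x) / Hbar x) atTop (nhds 0))
    (hdom : ∀ᶠ x in atTop, Fm x ≤ Hbar x)
    (δ₀ : ℝ) (hδ₀ : δ₀ = (d : ℝ) / β 0) :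
    Integrable (fun ω => m ω ^ δ₀) P ∧
    0 < ∫ ω, m ω ^ δ₀ ∂P ∧
    Tendsto (fun t => t ^ δ₀ * FP t) atTop
      (nhds ((∫ ω, m ω ^ δ₀ ∂P) / (A 0 ^ δ₀ * (R K) ^ d))) ∧
    ∀ u > (0:ℝ), Tendsto (fun t => FP (u * t) / FP t) atTop (nhds (u ^ (-δ₀))) := by
  have hFm' : ∀ x, Fm x = P.real {ω | x < m ω} := hFm
  have hδpos : 0 < δ₀ := hδ₀ ▸ div_pos (Nat.cast_pos.2 hd) hβ0
  have htail : (fun x => P.real {ω | x < m ω}) =O[atTop] fun x => x ^ (-(δ₀ + 1)) := by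
    refine Asymptotics.IsBigO.trans (Asymptotics.IsBigO.of_bound 1 ?_)
      (isBigO_rpow_neg_of_rapidly_varying hHpos hHanti (hHrapid 2 one_lt_two)
        (by linarith : 0 < δ₀ + 1))
    filter_upwards [hdom, eventually_gt_atTop 0] with x hx hx0
    rw [one_mul, norm_of_nonneg measureReal_nonneg, norm_of_nonneg (hHpos x hx0).le, ← hFm' x]
    exact hx
  have hint : Integrable (fun ω => m ω ^ δ₀) P :=
    integrable_rpow_of_tail_isBigO hm_nonneg hm_meas hδpos (lt_add_one δ₀) htail
  have hmean : 0 < ∫ ω, m ω ^ δ₀ ∂P := by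
    rw [integral_pos_iff_support_of_nonneg (fun ω => rpow_nonneg (hm_nonneg ω) _) hint]
    refine hm_pos.trans_le (measure_mono fun ω hω => ?_)
    exact (rpow_pos_of_pos hω _).ne'
  obtain ⟨hRK, g, hg, hlg, c, hc, hcl⟩ :=
    multislope_measurable_and_lower_bound hR0 hRmono hβ0 hβpos hApos hl hK le_rfl
  have hR1 : 0 < R 1 := hR0 ▸ hRmono 0 hK
  have hA0 := hApos 0 hK
  have hlim : Tendsto (fun t => t ^ δ₀ * FP t) atTop
      (nhds ((∫ ω, m ω ^ δ₀ ∂P) / (A 0 ^ δ₀ * (R K) ^ d))) := by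
    subst hδ₀
    refine (tendsto_rpow_mul_integral_tail hm_nonneg hm_meas hd hA0 hβ0 hc hRK
      (lt_min hR1 hRK) hint hg (fun r hr hr' => ?_) fun r hr hr' => ?_).congr fun t => ?_
    · rw [← hlg r hr.le (hr'.trans_le (min_le_right _ _))]
      exact hl 0 hK r (hR0.trans_le hr.le) (hr'.trans_le (min_le_left _ _))
    · rw [← hlg r hr.le hr']
      exact hcl r hr hr'
    · rw [hFP t, intervalIntegral.integral_of_le hRK.le, intervalIntegral.integral_of_le hRK.le,
        integral_Ioc_eq_integral_Ioo, integral_Ioc_eq_integral_Ioo]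
      congr 1
      refine setIntegral_congr_fun measurableSet_Ioo fun r hr => ?_
      rw [hFm', hlg r hr.1.le hr.2]
  exact ⟨hint, hmean, hlim, fun u hu => tendsto_div_of_tendsto_rpow_mul (by positivity) hlim hu⟩
end

section
/- (Theorem 1, rapidly varying channel power, bounded near field: tail equivalence) Consider the multi-slope pathloss setup with K ≥ 2 and β₀ = 0. Suppose F̄_m(x) > 0 for all x and F̄_m is rapidly varying at infinity. Then F̄_P(t) / F̄_m(A₀ t) → (R₁/R∞)^d as t → ∞, i.e. F̄_P and the tail F̄_m(A₀ ·) are tail-equivalent with constant (R₁/R∞)^d. -/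
open MeasureTheory Filter Real Set

/-- A multi-slope pathloss function is monotone on its domain. -/
theorem multislope_monotoneOn {K : ℕ} {R β A : ℕ → ℝ} {l : ℝ → ℝ}
    (hR0 : R 0 = 0) (hRmono : ∀ k < K, R k < R (k + 1))
    (hβ : ∀ k < K, 0 ≤ β k) (hApos : ∀ k < K, 0 < A k)
    (hcont : ∀ k, k + 1 < K → A k * R (k + 1) ^ β k = A (k + 1) * R (k + 1) ^ β (k + 1))
    (hl : ∀ k < K, ∀ r, R k ≤ r → r < R (k + 1) → l r = A k * r ^ β k) (k : ℕ) (hk : k < K) :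
    0 ≤ R k ∧ MonotoneOn l (Ico 0 (R (k + 1))) ∧
      ∀ r ∈ Ico 0 (R (k + 1)), l r ≤ A k * R (k + 1) ^ β k := by
  have mono : ∀ k < K, ∀ {x y : ℝ}, 0 ≤ x → x ≤ y → A k * x ^ β k ≤ A k * y ^ β k :=
    fun k hk x y hx hxy =>
      mul_le_mul_of_nonneg_left (rpow_le_rpow hx hxy (hβ k hk)) (hApos k hk).le
  induction k with
  | zero =>
    refine ⟨hR0.ge, fun x hx y hy hxy => ?_, fun r hr => ?_⟩
    · rw [hl 0 hk x (hR0.trans_le hx.1) hx.2, hl 0 hk y (hR0.trans_le hy.1) hy.2]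
      exact mono 0 hk hx.1 hxy
    · rw [hl 0 hk r (hR0.trans_le hr.1) hr.2]
      exact mono 0 hk hr.1 hr.2.le
  | succ k ih =>
    obtain ⟨hRk, hmono, hbound⟩ := ih (by lia)
    have hR : 0 ≤ R (k + 1) := hRk.trans (hRmono k (by lia)).le
    refine ⟨hR, fun x hx y hy hxy => ?_, fun r hr => ?_⟩
    · rcases lt_or_ge y (R (k + 1)) with h | h
      · exact hmono ⟨hx.1, hxy.trans_lt h⟩ ⟨hy.1, h⟩ hxy
      · rw [hl (k + 1) hk y h hy.2]
        rcases lt_or_ge x (R (k + 1)) with h' | h'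
        · exact (hbound x ⟨hx.1, h'⟩).trans ((hcont k hk).trans_le (mono _ hk hR h))
        · rw [hl (k + 1) hk x h' hx.2]
          exact mono _ hk hx.1 hxy
    · rcases lt_or_ge r (R (k + 1)) with h | h
      · exact (hbound r ⟨hr.1, h⟩).trans
          ((hcont k hk).trans_le (mono _ hk hR (hRmono _ hk).le))
      · rw [hl (k + 1) hk r h hr.2]
        exact mono _ hk hr.1 hr.2.le

/-- With a flat near field, the pathloss strictly exceeds its near-field value beyond `R 1`. -/
theorem multislope_lt_of_lt {K : ℕ} {R β A : ℕ → ℝ} {l : ℝ → ℝ}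
    (hR1 : 0 ≤ R 1) (hR12 : R 1 < R 2) (hβ0 : β 0 = 0) (hβ1 : 0 < β 1) (hA1 : 0 < A 1)
    (hcont : A 0 * R 1 ^ β 0 = A 1 * R 1 ^ β 1)
    (hl : ∀ r, R 1 ≤ r → r < R 2 → l r = A 1 * r ^ β 1) (hRK : R 2 ≤ R K)
    (hmono : MonotoneOn l (Ico 0 (R K))) {r : ℝ} (hr : R 1 < r) (hrK : r < R K) :
    A 0 < l r := by
  obtain ⟨s, hs1, hs⟩ := exists_between (lt_min hr hR12)
  obtain ⟨hsr, hs2⟩ := lt_min_iff.mp hs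
  calc A 0 = A 1 * R 1 ^ β 1 := by rw [← hcont, hβ0, rpow_zero, mul_one]
    _ < A 1 * s ^ β 1 := mul_lt_mul_of_pos_left (rpow_lt_rpow hR1 hs1 hβ1) hA1
    _ = l s := (hl s hs1.le hs2).symm
    _ ≤ l r := hmono ⟨hR1.trans hs1.le, hs2.trans_le hRK⟩ ⟨hR1.trans hr.le, hrK⟩ hsr.le

/-- If `F` is antitone, positive and rapidly varying, and `l` is monotone on `[0, b)`, equal to `c`
on `[0, a)` and larger than `c` on `(a, b)`, then the integrals of `F (t * l r)` against a
continuous weight, normalized by `F (c * t)`, converge to the integral of the weight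
over `[0, a]`. -/
theorem tendsto_integral_div_of_rapidlyVarying {F l w : ℝ → ℝ} {a b c : ℝ}
    (ha : 0 ≤ a) (hab : a ≤ b) (hc : 0 < c) (hF : Antitone F) (hFpos : ∀ x, 0 < F x)
    (hrapid : ∀ u > (1 : ℝ), Tendsto (fun x => F (u * x) / F x) atTop (nhds 0))
    (hl : MonotoneOn l (Ico 0 b)) (hlc : ∀ r, 0 ≤ r → r < a → l r = c)
    (hlt : ∀ r, a < r → r < b → c < l r) (hw : Continuous w) :
    Tendsto (fun t => (∫ r in (0 : ℝ)..b, F (t * l r) * w r) / F (c * t)) atTop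
      (nhds (∫ r in (0 : ℝ)..a, w r)) := by
  have hb : 0 ≤ b := ha.trans hab
  rw [← intervalIntegral.integral_indicator (f := w) (μ := volume) ⟨ha, hab⟩]
  simp_rw [← intervalIntegral.integral_div]
  refine intervalIntegral.tendsto_integral_filter_of_dominated_convergence (fun r => ‖w r‖)
    ?_ ?_ (hw.norm.intervalIntegrable 0 b) ?_
  · filter_upwards [eventually_ge_atTop 0] with t ht
    have hanti : AntitoneOn (fun r => F (t * l r)) (Ico 0 b) := fun x hx y hy hxy =>
      hF (mul_le_mul_of_nonneg_left (hl hx hy hxy) ht)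
    have hmeas := aemeasurable_restrict_of_antitoneOn (μ := volume) measurableSet_Ico hanti
    rw [Measure.restrict_congr_set Ico_ae_eq_Ioc, ← uIoc_of_le hb] at hmeas
    exact ((hmeas.mul hw.aemeasurable).div_const _).aestronglyMeasurable
  · filter_upwards [eventually_ge_atTop 0] with t ht
    filter_upwards [Measure.ae_ne volume a, Measure.ae_ne volume b] with r hra hrb hr
    rw [uIoc_of_le hb] at hr
    have hcl : c ≤ l r := by
      rcases lt_or_gt_of_ne hra with h | h
      · exact (hlc r hr.1.le h).ge
      · exact (hlt r h (lt_of_le_of_ne hr.2 hrb)).le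
    rw [norm_div, norm_mul, norm_of_nonneg (hFpos _).le, norm_of_nonneg (hFpos _).le,
      div_le_iff₀ (hFpos _), mul_comm]
    refine mul_le_mul_of_nonneg_left (hF ?_) (norm_nonneg _)
    rw [mul_comm c]
    exact mul_le_mul_of_nonneg_left hcl ht
  · filter_upwards [Measure.ae_ne volume a, Measure.ae_ne volume b] with r hra hrb hr
    rw [uIoc_of_le hb] at hr
    rcases lt_or_gt_of_ne hra with h | h
    · rw [indicator_of_mem (show r ∈ {x | x ≤ a} from h.le), hlc r hr.1.le h]
      refine tendsto_const_nhds.congr fun t => ?_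
      rw [mul_comm t, mul_div_cancel_left₀ _ (hFpos _).ne']
    · rw [indicator_of_notMem (show r ∉ {x | x ≤ a} from not_le.mpr h)]
      have hu : 1 < l r / c := (one_lt_div hc).mpr (hlt r h (lt_of_le_of_ne hr.2 hrb))
      have hlim := ((hrapid _ hu).comp (tendsto_id.const_mul_atTop hc)).mul_const (w r)
      rw [zero_mul] at hlim
      refine hlim.congr fun t => ?_
      have heq : l r / c * (c * t) = t * l r := by field_simp
      simp only [Function.comp_apply, id_eq, heq]
      ring

/-- **Theorem 1, rapidly varying channel power, bounded near field: tail equivalence.**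
In the multi-slope pathloss setup with `K ≥ 2` and `β₀ = 0`, if the channel-power tail `F̄_m`
is everywhere positive and rapidly varying at infinity, then
`F̄_P(t) / F̄_m(A₀ t) → (R₁/R∞)^d` as `t → ∞`. -/
theorem tail_received_power_rapidly_varying_bounded
    (d K : ℕ) (hd : 0 < d) (hK : 2 ≤ K)
    (R β A : ℕ → ℝ)
    (hR0 : R 0 = 0)
    (hRmono : ∀ k < K, R k < R (k + 1))
    (hβ0 : β 0 = 0)
    (hβpos : ∀ k, 1 ≤ k → k < K → 0 < β k)
    (hβmono : ∀ k, k + 1 < K → β k < β (k + 1))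
    (hApos : ∀ k < K, 0 < A k)
    (hcont : ∀ k, k + 1 < K → A k * R (k + 1) ^ β k = A (k + 1) * R (k + 1) ^ β (k + 1))
    {Ω : Type*} [MeasurableSpace Ω] (P : Measure Ω) [IsProbabilityMeasure P]
    (m : Ω → ℝ) (hm_nonneg : ∀ ω, 0 ≤ m ω) (hm_meas : Measurable m)
    (Fm : ℝ → ℝ) (hFm : ∀ x, Fm x = (P {ω | x < m ω}).toReal)
    (l : ℝ → ℝ) (hl : ∀ k < K, ∀ r, R k ≤ r → r < R (k + 1) → l r = A k * r ^ β k)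
    (FP : ℝ → ℝ)
    (hFP : ∀ t, FP t =
      ∫ r in (0:ℝ)..(R K), Fm (t * l r) * ((d : ℝ) * r ^ (d - 1) / (R K) ^ d))
    (hFmpos : ∀ x, 0 < Fm x)
    (hFmrapid : ∀ u > (1:ℝ), Tendsto (fun x => Fm (u * x) / Fm x) atTop (nhds 0)) :
    Tendsto (fun t => FP t / Fm (A 0 * t)) atTop (nhds ((R 1 / R K) ^ d)) := by
  have hβ : ∀ k < K, 0 ≤ β k := fun k hk => by
    rcases Nat.eq_zero_or_pos k with rfl | h
    · exact hβ0.ge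
    · exact (hβpos k h hk).le
  have hR1 : 0 < R 1 := hR0 ▸ hRmono 0 (by lia)
  have hR12 : R 1 < R 2 := hRmono 1 (by lia)
  have hRle : ∀ k, 2 ≤ k → k ≤ K → R 2 ≤ R k := fun k hk =>
    Nat.le_induction (fun _ => le_rfl)
      (fun n _ ih hn => (ih (by lia)).trans (hRmono n (by lia)).le) k hk
  have hRK : R 2 ≤ R K := hRle K hK le_rfl
  have hmono : MonotoneOn l (Ico 0 (R K)) := by
    have h := (multislope_monotoneOn hR0 hRmono hβ hApos hcont hl (K - 1) (by lia)).2.1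
    rwa [Nat.sub_add_cancel (by lia)] at h
  have hanti : Antitone Fm := fun x y hxy => by
    rw [hFm, hFm]
    exact measureReal_mono fun ω hω => hxy.trans_lt hω
  have hmain := tendsto_integral_div_of_rapidlyVarying
    (w := fun r => (d : ℝ) * r ^ (d - 1) / R K ^ d) hR1.le (hR12.le.trans hRK)
    (hApos 0 (by lia)) hanti hFmpos hFmrapid hmono
    (fun r h0 h1 => by rw [hl 0 (by lia) r (hR0.trans_le h0) h1, hβ0, rpow_zero, mul_one])
    (fun r h1 hK' => multislope_lt_of_lt hR1.le hR12 hβ0 (hβpos 1 le_rfl hK) (hApos 1 hK)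
      (hcont 0 hK) (hl 1 hK) hRK hmono h1 hK') (by fun_prop)
  have hint : ∫ r in (0 : ℝ)..R 1, (d : ℝ) * r ^ (d - 1) / R K ^ d = (R 1 / R K) ^ d := by
    have hd' : (d : ℝ) ≠ 0 := by exact_mod_cast hd.ne'
    rw [intervalIntegral.integral_div, intervalIntegral.integral_const_mul, integral_pow,
      Nat.sub_add_cancel hd, zero_pow hd.ne', div_pow, ← Nat.cast_add_one,
      Nat.sub_add_cancel hd, sub_zero, mul_div_cancel₀ _ hd']
  rw [← hint]
  simpa only [hFP] using hmain
end

section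
/- (Truncated moment asymptotics for rapidly varying tails) Let μ be a finite Borel measure on (0,∞) with tail F̄(x) = μ((x,∞)) satisfying F̄(x) > 0 for all x > 0, and suppose F̄ is rapidly varying at infinity. Then for any constants 0 < a < b and any δ ∈ ℝ, the truncated moment ∫_{(a t, b t]} x^δ dμ(x) is asymptotically equivalent to a^δ t^δ F̄(a t) as t → ∞, i.e. their ratio tends to 1. -/
open MeasureTheory Filter Real Set

/-- If the tail of `μ` is rapidly varying, then the rescaled measures
`μ(s · ∩ (s, ∞)) / μ((s, ∞))` concentrate at `1`, as tested on functions continuous on `[1, c]`. -/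
theorem tendsto_setIntegral_Ioc_div_tail
    (μ : Measure ℝ) [IsFiniteMeasure μ]
    (hpos : ∀ x > (0:ℝ), 0 < μ.real (Ioi x))
    (hrapid : ∀ u > (1:ℝ), Tendsto (fun x => μ.real (Ioi (u * x)) / μ.real (Ioi x)) atTop (nhds 0))
    {c : ℝ} (hc : 1 < c) {g : ℝ → ℝ} (hg : ContinuousOn g (Icc 1 c)) :
    Tendsto (fun s => (∫ x in Ioc s (c * s), g (x / s) ∂μ) / μ.real (Ioi s)) atTop
      (nhds (g 1)) := by
  obtain ⟨M, hM⟩ := isCompact_Icc.exists_bound_of_continuousOn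
    (hg.sub (continuousOn_const (c := g 1)))
  have hM0 : 0 ≤ M := (norm_nonneg _).trans (hM 1 ⟨le_rfl, hc.le⟩)
  rw [Metric.tendsto_nhds]
  intro ε hε
  obtain ⟨u, hu1, huc, hu⟩ : ∃ u, 1 < u ∧ u ≤ c ∧ ∀ y ∈ Icc 1 u, ‖g y - g 1‖ ≤ ε / 3 := by
    obtain ⟨η, hη, h⟩ := Metric.continuousWithinAt_iff.1 (hg 1 ⟨le_rfl, hc.le⟩) (ε / 3)
      (by positivity)
    refine ⟨min c (1 + η / 2), lt_min hc (by linarith), min_le_left _ _, fun y hy => ?_⟩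
    have hyη := hy.2.trans (min_le_right _ _)
    refine (h ⟨hy.1, hy.2.trans (min_le_left _ _)⟩ ?_).le
    rw [Real.dist_eq, abs_lt]
    constructor <;> linarith [hy.1]
  have hlimM := (hrapid u hu1).const_mul M
  have hlimg := (hrapid c hc).const_mul |g 1|
  rw [mul_zero] at hlimM hlimg
  filter_upwards [eventually_gt_atTop 0, hlimM.eventually_lt_const (show 0 < ε / 3 by positivity),
    hlimg.eventually_lt_const (show 0 < ε / 3 by positivity)] with s hs hsM hsg
  have hF := hpos s hs
  have hsu : s ≤ u * s := le_mul_of_one_le_left hs.le hu1.le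
  have huc' : u * s ≤ c * s := by gcongr
  have hint : IntegrableOn (fun x => g (x / s)) (Ioc s (c * s)) μ := by
    refine (ContinuousOn.integrableOn_Icc ?_).mono_set Ioc_subset_Icc_self
    refine hg.comp (by fun_prop) fun x hx => ?_
    exact ⟨(one_le_div hs).2 hx.1, (div_le_iff₀ hs).2 hx.2⟩
  have hintsub : IntegrableOn (fun x => g (x / s) - g 1) (Ioc s (c * s)) μ :=
    hint.sub (integrable_const _)
  have hsplit : ∫ x in Ioc s (c * s), (g (x / s) - g 1) ∂μ =
      (∫ x in Ioc s (u * s), (g (x / s) - g 1) ∂μ) +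
        ∫ x in Ioc (u * s) (c * s), (g (x / s) - g 1) ∂μ := by
    rw [← Ioc_union_Ioc_eq_Ioc hsu huc']
    exact setIntegral_union (Ioc_disjoint_Ioc_of_le le_rfl) measurableSet_Ioc
      (hintsub.mono_set (Ioc_subset_Ioc_right huc')) (hintsub.mono_set (Ioc_subset_Ioc_left hsu))
  have hnear : ‖∫ x in Ioc s (u * s), (g (x / s) - g 1) ∂μ‖ ≤ ε / 3 * μ.real (Ioi s) := by
    refine (norm_setIntegral_le_of_norm_le_const (measure_lt_top _ _) fun x hx =>
      hu _ ⟨(one_le_div hs).2 hx.1.le, (div_le_iff₀ hs).2 hx.2⟩).trans ?_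
    gcongr
    exacts [measure_ne_top _ _, Ioc_subset_Ioi_self]
  have hfar : ‖∫ x in Ioc (u * s) (c * s), (g (x / s) - g 1) ∂μ‖ ≤ M * μ.real (Ioi (u * s)) := by
    refine (norm_setIntegral_le_of_norm_le_const (measure_lt_top _ _) fun x hx =>
      hM _ ⟨(one_le_div hs).2 (hsu.trans hx.1.le), (div_le_iff₀ hs).2 hx.2⟩).trans ?_
    gcongr
    exacts [measure_ne_top _ _, Ioc_subset_Ioi_self]
  have hmass : μ.real (Ioc s (c * s)) = μ.real (Ioi s) - μ.real (Ioi (c * s)) := by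
    rw [← Ioc_union_Ioi_eq_Ioi (hsu.trans huc'), measureReal_union _ measurableSet_Ioi]
    · ring
    · exact Ioc_disjoint_Ioi le_rfl
  have hsub : ∫ x in Ioc s (c * s), (g (x / s) - g 1) ∂μ =
      (∫ x in Ioc s (c * s), g (x / s) ∂μ) - (μ.real (Ioi s) - μ.real (Ioi (c * s))) * g 1 := by
    rw [integral_sub hint (integrable_const _), setIntegral_const, hmass, smul_eq_mul]
  rw [← mul_div_assoc, div_lt_iff₀ hF] at hsM hsg
  have hdiff : (∫ x in Ioc s (c * s), g (x / s) ∂μ) / μ.real (Ioi s) - g 1 =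
      ((∫ x in Ioc s (u * s), (g (x / s) - g 1) ∂μ) +
        (∫ x in Ioc (u * s) (c * s), (g (x / s) - g 1) ∂μ) -
        g 1 * μ.real (Ioi (c * s))) / μ.real (Ioi s) := by
    rw [← hsplit, hsub]
    field_simp
    ring
  rw [Real.dist_eq, hdiff, abs_div, abs_of_pos hF, div_lt_iff₀ hF]
  rw [Real.norm_eq_abs] at hnear hfar
  refine (abs_sub _ _).trans_lt ?_
  rw [abs_mul, abs_of_nonneg (measureReal_nonneg (μ := μ) (s := Ioi (c * s)))]
  refine (add_le_add_left (abs_add_le _ _) _).trans_lt ?_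
  linarith

/-- **Truncated moment asymptotics for rapidly varying tails.** Let `μ` be a finite Borel
measure on `(0,∞)` with everywhere positive tail `F̄(x) = μ((x,∞))` that is rapidly varying
at infinity. Then for `0 < a < b` and any `δ ∈ ℝ`,
`∫_{(a t, b t]} x^δ dμ(x) ~ a^δ t^δ F̄(a t)` as `t → ∞`. -/
theorem truncated_moment_rapidly_varying
    (μ : Measure ℝ) [IsFiniteMeasure μ]
    (hsupp : μ (Set.Iic 0) = 0)
    (hpos : ∀ x > (0:ℝ), 0 < (μ (Set.Ioi x)).toReal)
    (hrapid : ∀ u > (1:ℝ),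
      Tendsto (fun x => (μ (Set.Ioi (u * x))).toReal / (μ (Set.Ioi x)).toReal) atTop (nhds 0))
    (a b : ℝ) (ha : 0 < a) (hab : a < b) (δ : ℝ) :
    Tendsto (fun t => (∫ x in Set.Ioc (a * t) (b * t), x ^ δ ∂μ) /
      (a ^ δ * t ^ δ * (μ (Set.Ioi (a * t))).toReal)) atTop (nhds 1) := by
  have hc : 1 < b / a := (one_lt_div ha).2 hab
  have hg : ContinuousOn (fun y : ℝ => y ^ δ) (Icc 1 (b / a)) := fun y hy =>
    (continuousAt_rpow_const y δ (Or.inl (by linarith [hy.1]))).continuousWithinAt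
  have h := (tendsto_setIntegral_Ioc_div_tail μ hpos hrapid hc hg).comp
    (tendsto_id.const_mul_atTop ha)
  rw [one_rpow] at h
  refine h.congr' ?_
  filter_upwards [eventually_gt_atTop 0] with t ht
  have hat : 0 < a * t := mul_pos ha ht
  have hbt : b / a * (a * t) = b * t := by field_simp
  have hscale : ∫ x in Ioc (a * t) (b * t), (x / (a * t)) ^ δ ∂μ =
      (∫ x in Ioc (a * t) (b * t), x ^ δ ∂μ) / (a * t) ^ δ := by
    rw [← integral_div]
    exact setIntegral_congr_fun measurableSet_Ioc fun x hx =>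
      div_rpow (hat.trans hx.1).le hat.le δ
  simp only [Function.comp_apply, id_eq]
  rw [hbt, hscale, mul_rpow ha.le ht.le, div_div, measureReal_def]
end

section
/- (Karamata asymptotics over expanding intervals) Let L be a positive measurable function on (0,∞), slowly varying at infinity and locally bounded on [x₀,∞) for some x₀ ≥ 0. Then for any constants 0 < a < b and any ρ > 0, ∫_{a t}^{b t} x^{ρ-1} L(x) dx is asymptotically equivalent to ρ^{-1} (b^ρ − a^ρ) t^ρ L(t) as t → ∞, i.e. the ratio of the two quantities tends to 1. -/
open MeasureTheory Filter Real Set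

/-- If the increments of a measurable function tend to zero pointwise at infinity, then on each
bounded interval of increments they tend to zero in measure. -/
lemma tendsto_measure_large_increments {h : ℝ → ℝ} (hm : Measurable h)
    (hh : ∀ s, Tendsto (fun x => h (x + s) - h x) atTop (nhds 0)) (c d : ℝ) :
    Tendsto (fun x => volume ({s | 1 ≤ |h (x + s) - h x|} ∩ Icc c d)) atTop (nhds 0) := by
  refine tendsto_of_seq_tendsto fun u hu => ?_
  have hmeas := tendstoInMeasure_of_tendsto_ae (μ := volume.restrict (Icc c d))
    (f := fun n s => h (u n + s) - h (u n)) (g := fun _ => 0)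
    (fun n => (by fun_prop : Measurable fun s => h (u n + s) - h (u n)).aestronglyMeasurable)
    (ae_of_all _ fun s => (hh s).comp hu)
  rw [tendstoInMeasure_iff_norm] at hmeas
  simpa only [sub_zero, Function.comp_def, Real.norm_eq_abs, Measure.restrict_apply' measurableSet_Icc]
    using hmeas 1 one_pos

/-- If the increments of a measurable function tend to zero pointwise at infinity, then they are
eventually bounded uniformly over each bounded interval of increments. -/
lemma eventually_abs_increment_le_two {h : ℝ → ℝ} (hm : Measurable h)
    (hh : ∀ s, Tendsto (fun x => h (x + s) - h x) atTop (nhds 0)) (c d : ℝ) :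
    ∀ᶠ x in atTop, ∀ u ∈ Icc c d, |h (x + u) - h x| ≤ 2 := by
  have half_pos : (0 : ENNReal) < 1 / 2 := by simp
  have hlarge (c' d' : ℝ) := eventually_atTop.mp
    ((tendsto_measure_large_increments hm hh c' d').eventually_lt_const half_pos)
  obtain ⟨X, hX⟩ := hlarge c (d + 1)
  obtain ⟨Y, hY⟩ := hlarge 0 1
  filter_upwards [eventually_ge_atTop X, eventually_ge_atTop (Y - c)] with x hxX hxY u hu
  by_contra! hlt
  set P := {s | 1 ≤ |h (x + s) - h x|} ∩ Icc c (d + 1)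
  set Q := {v | 1 ≤ |h (x + u + v) - h (x + u)|} ∩ Icc (0 : ℝ) 1
  have hP : volume P < 1 / 2 := hX x hxX
  have hQ : volume Q < 1 / 2 := hY (x + u) (by linarith [hu.1])
  have hcover : Icc u (u + 1) ⊆ P ∪ (fun s => s + -u) ⁻¹' Q := by
    intro s hs
    by_cases hsP : 1 ≤ |h (x + s) - h x|
    · exact Or.inl ⟨hsP, by linarith [hs.1, hu.1], by linarith [hs.2, hu.2]⟩
    · refine Or.inr ⟨?_, by linarith [hs.1], by linarith [hs.2]⟩
      have hshift : x + u + (s + -u) = x + s := by ring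
      simp only [mem_ofPred_eq, hshift]
      have := abs_sub_le (h (x + u)) (h (x + s)) (h x)
      rw [abs_sub_comm (h (x + u)) (h (x + s))] at this
      linarith
  have hle : volume (Icc u (u + 1)) ≤ volume P + volume Q := by
    refine (measure_mono hcover).trans ((measure_union_le _ _).trans_eq ?_)
    rw [measure_preimage_add_right]
  have hsum : volume P + volume Q < 1 := by
    simpa [ENNReal.inv_two_add_inv_two] using ENNReal.add_lt_add hP hQ
  simp only [Real.volume_Icc, add_sub_cancel_left, ENNReal.ofReal_one] at hle
  exact hle.not_gt hsum

/-- The ratios `L (u * t) / L t` of a measurable slowly varying function are eventually bounded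
uniformly for `u` in a compact subinterval of `(0, ∞)`. -/
lemma eventually_slowlyVarying_ratio_le {L : ℝ → ℝ} (hLpos : ∀ x > 0, 0 < L x)
    (hLmeas : Measurable L)
    (hLslow : ∀ t > 0, Tendsto (fun x => L (t * x) / L x) atTop (nhds 1))
    {a : ℝ} (ha : 0 < a) (b : ℝ) :
    ∀ᶠ t in atTop, ∀ u ∈ Icc a b, L (u * t) / L t ≤ exp 2 := by
  have hincr (s : ℝ) :
      Tendsto (fun x => log (L (exp (x + s))) - log (L (exp x))) atTop (nhds 0) := by
    have hlog := (((hLslow (exp s) (exp_pos s)).comp tendsto_exp_atTop).log one_ne_zero)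
    rw [log_one] at hlog
    refine hlog.congr fun x => ?_
    simp only [Function.comp_apply]
    rw [← exp_add, add_comm s, log_div (hLpos _ (exp_pos _)).ne' (hLpos _ (exp_pos _)).ne']
  have hbound := eventually_abs_increment_le_two (h := fun x => log (L (exp x)))
    (by fun_prop) hincr (log a) (log b)
  filter_upwards [tendsto_log_atTop.eventually hbound, eventually_gt_atTop 0] with t ht ht0 u hu
  have hu0 : 0 < u := ha.trans_le hu.1
  have := (le_abs_self _).trans
    (ht (log u) ⟨log_le_log ha hu.1, log_le_log hu0 hu.2⟩)
  rw [exp_add, exp_log ht0, exp_log hu0, mul_comm t,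
    ← log_div (hLpos _ (mul_pos hu0 ht0)).ne' (hLpos _ ht0).ne'] at this
  exact (log_le_iff_le_exp (div_pos (hLpos _ (mul_pos hu0 ht0)) (hLpos _ ht0))).mp this

/-- Rescaling the variable of integration by `t` in the integral of `x ^ (ρ - 1) * L x`. -/
lemma integral_rpow_mul_eq_rescaled (L : ℝ → ℝ) {a b t : ℝ} (ha : 0 < a) (hab : a ≤ b)
    (ht : 0 < t) (hLt : L t ≠ 0) (ρ : ℝ) :
    ∫ x in (a * t)..(b * t), x ^ (ρ - 1) * L x =
      t ^ ρ * L t * ∫ u in a..b, u ^ (ρ - 1) * (L (u * t) / L t) := by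
  rw [← intervalIntegral.smul_integral_comp_mul_right, smul_eq_mul,
    ← intervalIntegral.integral_const_mul, ← intervalIntegral.integral_const_mul]
  refine intervalIntegral.integral_congr fun u hu => ?_
  rw [uIcc_of_le hab] at hu
  have hu0 : 0 < u := ha.trans_le hu.1
  rw [mul_rpow hu0.le ht.le, rpow_sub_one ht.ne']
  field_simp

/-- **Karamata asymptotics over expanding intervals.** Let `L` be a positive measurable
function on `(0,∞)`, slowly varying at infinity and locally bounded on `[x₀,∞)` for some
`x₀ ≥ 0`. Then for `0 < a < b` and `ρ > 0`,
`∫_{a t}^{b t} x^{ρ-1} L(x) dx ~ ρ⁻¹ (b^ρ − a^ρ) t^ρ L(t)` as `t → ∞`. -/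
theorem karamata_expanding_intervals
    (L : ℝ → ℝ) (x₀ : ℝ) (hx₀ : 0 ≤ x₀)
    (hLpos : ∀ x > 0, 0 < L x)
    (hLmeas : Measurable L)
    (hLslow : ∀ t > 0, Tendsto (fun x => L (t * x) / L x) atTop (nhds 1))
    (hLloc : ∀ b ≥ x₀, ∃ C : ℝ, ∀ t ∈ Set.Icc x₀ b, |L t| ≤ C)
    (a b : ℝ) (ha : 0 < a) (hab : a < b) (ρ : ℝ) (hρ : 0 < ρ) :
    Tendsto (fun t => (∫ x in (a * t)..(b * t), x ^ (ρ - 1) * L x) /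
      (ρ⁻¹ * (b ^ ρ - a ^ ρ) * t ^ ρ * L t)) atTop (nhds 1) := by
  have hlim : Tendsto (fun t => ∫ u in a..b, u ^ (ρ - 1) * (L (u * t) / L t)) atTop
      (nhds (∫ u in a..b, u ^ (ρ - 1))) := by
    refine intervalIntegral.tendsto_integral_filter_of_dominated_convergence
      (fun u => u ^ (ρ - 1) * exp 2) ?_ ?_ ?_ ?_
    · exact Eventually.of_forall fun t => by fun_prop
    · filter_upwards [eventually_slowlyVarying_ratio_le hLpos hLmeas hLslow ha b,
        eventually_gt_atTop 0] with t ht ht0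
      refine ae_of_all _ fun u hu => ?_
      rw [uIoc_of_le hab.le] at hu
      have hu0 : 0 < u := ha.trans hu.1
      have hratio := div_pos (hLpos _ (mul_pos hu0 ht0)) (hLpos _ ht0)
      rw [norm_of_nonneg (mul_nonneg (rpow_nonneg hu0.le _) hratio.le)]
      exact mul_le_mul_of_nonneg_left (ht u ⟨hu.1.le, hu.2⟩) (rpow_nonneg hu0.le _)
    · exact (intervalIntegral.intervalIntegrable_rpow' (by linarith)).mul_const _
    · refine ae_of_all _ fun u hu => ?_
      rw [uIoc_of_le hab.le] at hu
      simpa using (hLslow u (ha.trans hu.1)).const_mul (u ^ (ρ - 1))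
  rw [integral_rpow (Or.inl (by linarith)), sub_add_cancel] at hlim
  have hpow : 0 < b ^ ρ - a ^ ρ := sub_pos.mpr (rpow_lt_rpow ha.le hab hρ)
  have hquot := hlim.div_const ((b ^ ρ - a ^ ρ) / ρ)
  rw [div_self (by positivity)] at hquot
  refine hquot.congr' ?_
  filter_upwards [eventually_gt_atTop 0] with t ht
  have hLt := (hLpos t ht).ne'
  have htρ := (rpow_pos_of_pos ht ρ).ne'
  rw [integral_rpow_mul_eq_rescaled L ha hab.le ht hLt]
  generalize ∫ u in a..b, u ^ (ρ - 1) * (L (u * t) / L t) = I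
  field_simp
end
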